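/- arXiv:1512.05302 — 3 statements merged into one kernel-verified Lean document; each statement's English description precedes it below -/
import Mathlib

section
/- If L is a linked system of n − 3 quartets of a binary phylogenetic tree T on n leaves (i.e., each quartet in L distinguishes a distinct internal edge of T and the associated graph G_T(L) is connected), then T is the unique binary phylogenetic tree displaying every quartet in L; that is, L is a definitive set of quartets. -/
open SimpleGraph

variable {V : Type*}

/-- `x` and `y` are joined by a walk in `G` avoiding the vertex set `S`. -/
def Avoids (G : SimpleGraph V) (S : Set V) (x y : V) : Prop :=
  ∃ w : G.Walk x y, ∀ u ∈ w.support, u ∉ S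

/-- `x` and `y` are joined by a walk in `G` avoiding the edge set `F`. -/
def AvoidsE (G : SimpleGraph V) (F : Set (Sym2 V)) (x y : V) : Prop :=
  ∃ w : G.Walk x y, ∀ e ∈ w.edges, e ∉ F

/-- A leaf of a tree: a vertex with exactly one neighbour (degree one). -/
def IsLeaf (G : SimpleGraph V) (v : V) : Prop := ∃! u, G.Adj v u

/-- An internal vertex of degree three: exactly three distinct neighbours. -/
def IsDeg3 (G : SimpleGraph V) (v : V) : Prop :=
  ∃ a b c, a ≠ b ∧ a ≠ c ∧ b ≠ c ∧ G.Adj v a ∧ G.Adj v b ∧ G.Adj v c ∧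
    ∀ u, G.Adj v u → u = a ∨ u = b ∨ u = c

/-- An unrooted binary phylogenetic tree: a tree all of whose vertices are
leaves (degree 1) or internal vertices of degree 3. -/
def IsBinaryTree (G : SimpleGraph V) : Prop :=
  G.IsTree ∧ ∀ v, IsLeaf G v ∨ IsDeg3 G v

/-- The tree displays the quartet `ab|cd`: there are vertex-disjoint walks
joining `a` to `b` and `c` to `d`. -/
def Displays (G : SimpleGraph V) (a b c d : V) : Prop :=
  ∃ (p : G.Walk a b) (q : G.Walk c d), ∀ u ∈ p.support, u ∉ q.support

/-- The quartet `ab|cd` distinguishes the path `p` between internal vertices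
`v1` and `v2`: `{a,b}` and `{c,d}` lie in different connected components of
the graph obtained by removing the path `p`, the `a`–`b` path passes through
`v1`, and the `c`–`d` path passes through `v2`. -/
def DistPath (G : SimpleGraph V) (a b c d v1 v2 : V) : Prop :=
  ∃ p : G.Walk v1 v2, p.IsPath ∧
    AvoidsE G {e | e ∈ p.edges} a b ∧ AvoidsE G {e | e ∈ p.edges} c d ∧
    ¬ AvoidsE G {e | e ∈ p.edges} a c ∧
    ¬ Avoids G {v1} a b ∧ ¬ Avoids G {v2} c d

variable {X : Type*}

/-- The labelled tree `(G, ℓ)` displays the quartet `q` on the taxa `X`. -/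
def DisplaysQ (G : SimpleGraph V) (ℓ : X → V) (q : Sym2 (Sym2 X)) : Prop :=
  ∃ a b c d : X, a ≠ b ∧ a ≠ c ∧ a ≠ d ∧ b ≠ c ∧ b ≠ d ∧ c ≠ d ∧
    q = s(s(a, b), s(c, d)) ∧ Displays G (ℓ a) (ℓ b) (ℓ c) (ℓ d)

/-- The quartet `q` distinguishes the path between `v1` and `v2` in the
labelled tree `(G, ℓ)`. -/
def QDist (G : SimpleGraph V) (ℓ : X → V) (q : Sym2 (Sym2 X)) (v1 v2 : V) : Prop :=
  ∃ a b c d : X, q = s(s(a, b), s(c, d)) ∧ DistPath G (ℓ a) (ℓ b) (ℓ c) (ℓ d) v1 v2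

/-- The support (taxon set) of a quartet. -/
def suppQ (q : Sym2 (Sym2 X)) : Set X := {x | ∃ p ∈ q, x ∈ p}

/-- Two quartets are linked (there is an edge between them in the graph
`G_T(L)`): they distinguish adjacent internal edges of the tree and the union
of their supports has cardinality 5. -/
def LinkedQ (G : SimpleGraph V) (ℓ : X → V) (q q' : Sym2 (Sym2 X)) : Prop :=
  ∃ u v w : V, u ≠ w ∧ G.Adj u v ∧ G.Adj v w ∧
    (QDist G ℓ q u v ∨ QDist G ℓ q v u) ∧
    (QDist G ℓ q' v w ∨ QDist G ℓ q' w v) ∧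
    (suppQ q ∪ suppQ q').ncard = 5

def Av (G : SimpleGraph V) (v x y : V) : Prop := Avoids G {v} x y

section tree
variable {G : SimpleGraph V}

theorem Av.symm {v x y : V} (h : Av G v x y) : Av G v y x := by
  obtain ⟨w, hw⟩ := h
  exact ⟨w.reverse, by simpa using hw⟩

theorem Av.trans {v x y z : V} (h : Av G v x y) (h' : Av G v y z) : Av G v x z := by
  obtain ⟨w, hw⟩ := h
  obtain ⟨w', hw'⟩ := h'
  refine ⟨w.append w', fun u hu => ?_⟩
  rw [Walk.mem_support_append_iff] at hu
  exact hu.elim (hw u) (hw' u)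

theorem Av.left {v x y : V} (h : Av G v x y) : x ≠ v := by
  obtain ⟨w, hw⟩ := h
  exact hw x w.start_mem_support

theorem Av.right {v x y : V} (h : Av G v x y) : y ≠ v := h.symm.left

theorem Av.rfl' {v x : V} (h : x ≠ v) : Av G v x x := ⟨Walk.nil, by simpa using h⟩

theorem Av.adj {v x y : V} (h : G.Adj x y) (hx : x ≠ v) (hy : y ≠ v) : Av G v x y :=
  ⟨Walk.cons h Walk.nil, by simp [hx, hy]⟩

theorem av_anti (hT : G.IsTree) {u v y : V} (huv : u ≠ v) (h : ¬ Av G u v y) : Av G v u y := by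
  classical
  obtain ⟨p, hp⟩ := (hT.connected.preconnected y u).exists_isPath
  by_cases hv : v ∈ p.support
  · exfalso
    apply h
    apply Av.symm
    refine ⟨p.takeUntil v hv, fun t ht => ?_⟩
    rintro rfl
    exact Walk.endpoint_notMem_support_takeUntil hp hv huv ht
  · apply Av.symm
    exact ⟨p, fun t ht => by rintro rfl; exact hv ht⟩

theorem av_nbr (hT : G.IsTree) {u x : V} (h : x ≠ u) : ∃ a, G.Adj u a ∧ Av G u a x := by
  obtain ⟨p, hp⟩ := (hT.connected.preconnected u x).exists_isPath
  cases p with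
  | nil => exact absurd rfl h
  | cons hadj p =>
    refine ⟨_, hadj, p, ?_⟩
    rw [Walk.cons_isPath_iff] at hp
    rintro t ht rfl
    exact hp.2 ht

theorem av_excl (hT : G.IsTree) {u v x : V} (h : G.Adj u v) (h1 : Av G u v x) : ¬ Av G v u x := by
  rintro h2
  have hb := (isAcyclic_iff_forall_isBridge.1 hT.isAcyclic) (e := s(u, v)) h
  rw [isBridge_iff_forall_walk_mem_edges] at hb
  obtain ⟨p, hp⟩ := h1.symm
  obtain ⟨q, hq⟩ := h2
  have := hb (q.append p)
  rw [Walk.edges_append, List.mem_append] at this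
  rcases this with h | h
  · exact hq _ (q.snd_mem_support_of_mem_edges h) rfl
  · exact hp _ (p.fst_mem_support_of_mem_edges h) rfl

theorem av_nbr_eq (hT : G.IsTree) {u a b : V} (ha : G.Adj u a) (hb : G.Adj u b)
    (h : Av G u a b) : a = b := by
  by_contra hab
  exact av_excl hT ha h (Av.adj hb ha.ne (Ne.symm hab))

theorem av_or (hT : G.IsTree) {u v : V} (h : G.Adj u v) (x : V) : Av G u v x ∨ Av G v u x := by
  by_cases h' : Av G u v x
  · exact Or.inl h'
  · exact Or.inr (av_anti hT h.ne h')

theorem av_path (hT : G.IsTree) {a b u : V} (p : G.Walk a b) (hp : p.IsPath)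
    (hu : u ∈ p.support) : ¬ Av G u a b := by
  classical
  rintro ⟨w, hw⟩
  have := hT.isAcyclic.path_unique ⟨p, hp⟩ w.toPath
  have h2 : p = w.bypass := congrArg Subtype.val this
  rw [h2] at hu
  exact hw u (w.support_bypass_subset_support hu) rfl

theorem disp_iff (hT : G.IsTree) {a b c d : V} :
    Displays G a b c d ↔ ∀ v, Av G v a b ∨ Av G v c d := by
  constructor
  · rintro ⟨p, q, h⟩ v
    by_cases hv : v ∈ p.support
    · exact Or.inr ⟨q, fun u hu => by rintro rfl; exact h _ hv hu⟩
    · exact Or.inl ⟨p, fun u hu => by rintro rfl; exact hv hu⟩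
  · intro h
    obtain ⟨p, hp⟩ := (hT.connected.preconnected a b).exists_isPath
    obtain ⟨q, hq⟩ := (hT.connected.preconnected c d).exists_isPath
    refine ⟨p, q, fun u hu hu' => ?_⟩
    rcases h u with h | h
    · exact av_path hT p hp hu h
    · exact av_path hT q hq hu' h

theorem median_exists (hT : G.IsTree) (x y z : V) :
    ∃ v, ¬ Av G v x y ∧ ¬ Av G v x z ∧ ¬ Av G v y z := by
  obtain ⟨p⟩ := hT.connected.preconnected z x
  induction p with
  | nil => exact ⟨_, fun h => h.left rfl, fun h => h.left rfl, fun h => h.right rfl⟩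
  | @cons z z' x hadj p ih =>
    obtain ⟨v, h1, h2, h3⟩ := ih
    by_cases hz : v = z
    · subst hz
      exact ⟨v, h1, fun h => h.right rfl, fun h => h.right rfl⟩
    by_cases hz' : v = z'
    · subst hz'
      have key : ∀ x y : V, ¬ Av G v x y → Av G v x z → ¬ Av G z x y := by
        intro x y hxy hx h
        have e1 : ¬ Av G v z y := fun h' => hxy (hx.trans h')
        have e2 : Av G z v y := av_anti hT (Ne.symm hadj.ne) e1
        exact av_excl hT hadj.symm hx.symm (e2.trans h.symm)
      by_cases hx : Av G v x z
      · exact ⟨z, key _ _ h1 hx, fun h => h.right rfl, fun h => h.right rfl⟩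
      by_cases hy : Av G v y z
      · exact ⟨z, fun h => key _ _ (fun h => h1 h.symm) hy h.symm,
          fun h => h.right rfl, fun h => h.right rfl⟩
      exact ⟨v, h1, hx, hy⟩
    · have e : Av G v z z' := Av.adj hadj (Ne.symm hz) (Ne.symm hz')
      exact ⟨v, h1, fun h => h2 (h.trans e), fun h => h3 (h.trans e)⟩

theorem median_unique (hT : G.IsTree) {x y z u v : V}
    (h1 : ¬ Av G v x y) (h2 : ¬ Av G v x z) (h3 : ¬ Av G v y z)
    (k1 : ¬ Av G u x y) (k2 : ¬ Av G u x z) (k3 : ¬ Av G u y z) : u = v := by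
  by_contra huv
  have key : ∀ t, Av G u v t ∨ Av G v u t := fun t => by
    by_cases h : Av G u v t
    · exact Or.inl h
    · exact Or.inr (av_anti hT huv h)
  rcases key x with a | a <;> rcases key y with b | b <;> rcases key z with c | c
  all_goals first
    | exact h1 (a.symm.trans b)
    | exact h2 (a.symm.trans c)
    | exact h3 (b.symm.trans c)
    | exact k1 (a.symm.trans b)
    | exact k2 (a.symm.trans c)
    | exact k3 (b.symm.trans c)

theorem disp_of_split (hT : G.IsTree) {a b c d u v : V} (h : G.Adj u v)
    (ha : Av G v u a) (hb : Av G v u b) (hc : Av G u v c) (hd : Av G u v d) :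
    Displays G a b c d := by
  rw [disp_iff hT]
  intro w
  by_cases hw : Av G v u w
  · right
    have hw' : ¬ Av G u v w := fun h' => av_excl hT h h' hw
    -- from c to v avoiding w
    have key : ∀ c, Av G u v c → Av G w c v := by
      rintro c ⟨p, hp⟩
      apply Av.symm
      refine ⟨p, fun t ht => ?_⟩
      rintro rfl
      classical
      exact hw' ⟨p.takeUntil t ht,
        fun s hs => hp s (p.support_takeUntil_subset_support ht hs)⟩
    exact (key c hc).trans (key d hd).symm
  · left
    have key : ∀ c, Av G v u c → Av G w c u := by
      rintro c ⟨p, hp⟩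
      apply Av.symm
      refine ⟨p, fun t ht => ?_⟩
      rintro rfl
      classical
      exact hw ⟨p.takeUntil t ht,
        fun s hs => hp s (p.support_takeUntil_subset_support ht hs)⟩
    exact (key a ha).trans (key b hb).symm

theorem split_of_disp (hT : G.IsTree) {a b c d : V} (h : Displays G a b c d) :
    ∃ u v, G.Adj u v ∧ Av G v u a ∧ Av G v u b ∧ Av G u v c ∧ Av G u v d := by
  rw [disp_iff hT] at h
  obtain ⟨m, h1, h2, h3⟩ := median_exists hT a b c
  have hcd : Av G m c d := (h m).resolve_left h1
  obtain ⟨n, hn, hnc⟩ := av_nbr hT hcd.left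
  refine ⟨m, n, hn, ?_, ?_, hnc, hnc.trans hcd⟩
  · exact (av_or hT hn a).resolve_left fun h => h2 (h.symm.trans hnc)
  · exact (av_or hT hn b).resolve_left fun h => h3 (h.symm.trans hnc)

theorem disp_comm {a b c d : V} (h : Displays G a b c d) : Displays G c d a b := by
  obtain ⟨p, q, h⟩ := h
  exact ⟨q, p, fun u hu hu' => h u hu' hu⟩

theorem disp_sl {a b c d : V} (h : Displays G a b c d) : Displays G b a c d := by
  obtain ⟨p, q, h⟩ := h
  exact ⟨p.reverse, q, by simpa using h⟩

theorem disp_sr {a b c d : V} (h : Displays G a b c d) : Displays G a b d c := by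
  obtain ⟨p, q, h⟩ := h
  exact ⟨p, q.reverse, by simpa using h⟩

theorem disp_five (hT : G.IsTree) {a b c d : V} (h : Displays G a b c d) (e : V) :
    (Displays G a b c e ∧ Displays G a b d e) ∨ (Displays G a e c d ∧ Displays G b e c d) := by
  obtain ⟨u, v, h, ha, hb, hc, hd⟩ := split_of_disp hT h
  rcases av_or hT h e with he | he
  · exact Or.inl ⟨disp_of_split hT h ha hb hc he, disp_of_split hT h ha hb hd he⟩
  · exact Or.inr ⟨disp_of_split hT h ha he hc hd, disp_of_split hT h hb he hc hd⟩

theorem disp_excl (hT : G.IsTree) {a b c d : V} (h : Displays G a b c d) :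
    ¬ Displays G a c b d := by
  intro h'
  obtain ⟨u, v, h, ha, hb, hc, hd⟩ := split_of_disp hT h
  rw [disp_iff hT] at h'
  rcases h' u with e | e
  · exact av_excl hT h (hc.trans e.symm) ha
  · exact av_excl hT h (hd.trans e.symm) hb

theorem disp_trans (hT : G.IsTree) {a b c d e : V} (h : Displays G a b c d)
    (h' : Displays G a e c d) : Displays G b e c d := by
  rw [disp_iff hT] at *
  intro v
  rcases h v with k | k
  · rcases h' v with k' | k'
    · exact Or.inl (k.symm.trans k')
    · exact Or.inr k'
  · exact Or.inr k

theorem leaf_av (hT : G.IsTree) {a x y : V} (h : IsLeaf G a) (hx : x ≠ a) (hy : y ≠ a) :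
    Av G a x y := by
  obtain ⟨n, hn, hu⟩ := h
  obtain ⟨n1, h1, k1⟩ := av_nbr hT hx
  obtain ⟨n2, h2, k2⟩ := av_nbr hT hy
  obtain rfl := hu n1 h1
  obtain rfl := hu n2 h2
  exact k1.symm.trans k2

theorem disp_self (hT : G.IsTree) {a c d : V} (h : IsLeaf G a) (hx : c ≠ a) (hy : d ≠ a) :
    Displays G a a c d := by
  rw [disp_iff hT]
  intro v
  by_cases hv : a = v
  · subst hv
    exact Or.inr (leaf_av hT h hx hy)
  · exact Or.inl (Av.rfl' hv)

theorem disp_ne (hT : G.IsTree) {a b c d : V} (h : Displays G a b c d) : a ≠ c := by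
  rintro rfl
  obtain ⟨p, q, h⟩ := h
  exact h _ p.start_mem_support q.start_mem_support

theorem exists_leaf [Finite V] (hT : IsBinaryTree G) (u a : V) (h : G.Adj u a) :
    ∃ x, IsLeaf G x ∧ Av G u a x := by
  generalize hn : {x | Av G u a x}.ncard = n
  induction n using Nat.strong_induction_on generalizing u a with
  | _ n ih =>
    rcases hT.2 a with hl | ⟨p, q, r, hpq, hpr, hqr, hp, hq, hr, -⟩
    · exact ⟨a, hl, Av.rfl' h.ne.symm⟩
    · have : ∃ b, G.Adj a b ∧ b ≠ u := by
        by_cases hpu : p = u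
        · exact ⟨q, hq, fun h => hpq (hpu.trans h.symm)⟩
        · exact ⟨p, hp, hpu⟩
      obtain ⟨b, hb, hbu⟩ := this
      have sub : ∀ x, Av G a b x → Av G u a x := by
        intro x hx
        refine (av_or hT.1 h x).resolve_right fun h' => ?_
        exact hbu (av_nbr_eq hT.1 hb h.symm (hx.trans h'.symm))
      have hlt : {x | Av G a b x}.ncard < {x | Av G u a x}.ncard := by
        apply Set.ncard_lt_ncard _ (Set.toFinite _)
        refine ⟨sub, fun hs => ?_⟩
        have : Av G a b a := hs (Av.rfl' h.ne.symm)
        exact this.right rfl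
      obtain ⟨x, hx, hx'⟩ := ih _ (hn ▸ hlt) a b hb rfl
      exact ⟨x, hx, sub x hx'⟩

theorem avoidsE_side (hT : G.IsTree) {u v x y : V} (huv : G.Adj u v)
    (h : AvoidsE G {s(u, v)} x y) : Av G v u x → Av G v u y := by
  obtain ⟨w, hw⟩ := h
  induction w with
  | nil => exact id
  | @cons x y z hadj p ih =>
    intro hx
    simp only [Walk.edges_cons, List.mem_cons] at hw
    apply ih (fun e he => hw e (Or.inr he))
    by_cases hy : y = v
    · exfalso
      subst hy
      have : u = x := av_nbr_eq hT huv.symm hadj.symm hx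
      subst this
      exact hw _ (Or.inl rfl) rfl
    · exact hx.trans (Av.adj hadj hx.right hy)

theorem avoidsE_symm {F : Set (Sym2 V)} {x y : V} (h : AvoidsE G F x y) : AvoidsE G F y x := by
  obtain ⟨w, hw⟩ := h
  exact ⟨w.reverse, by simpa using hw⟩

/-- The quartet `ab|cd` distinguishes the edge `uv` of the tree. -/
def QE (G : SimpleGraph V) (a b c d u v : V) : Prop :=
  Av G v u a ∧ Av G v u b ∧ Av G u v c ∧ Av G u v d ∧ ¬ Av G u a b ∧ ¬ Av G v c d

theorem QE_of_distPath (hT : G.IsTree) {a b c d u v : V} (huv : G.Adj u v)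
    (h : DistPath G a b c d u v) : QE G a b c d u v := by
  obtain ⟨p, hp, hab, hcd, hac, h1, h2⟩ := h
  have hpe : {e | e ∈ p.edges} = {s(u, v)} := by
    have := hT.isAcyclic.path_unique ⟨p, hp⟩ (Path.singleton huv)
    have h2 : p = Walk.cons huv Walk.nil := congrArg Subtype.val this
    rw [h2]
    ext e
    simp
  rw [hpe] at hab hcd hac
  have s1 := avoidsE_side hT huv hab
  have s1' := avoidsE_side hT huv (avoidsE_symm hab)
  have s2' := avoidsE_side hT huv (avoidsE_symm hcd)
  rcases av_or hT huv a with ha | ha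
  · exfalso
    rcases av_or hT huv b with hb | hb
    · exact h1 (ha.symm.trans hb)
    · exact av_excl hT huv ha (s1' hb)
  · have hc : ¬ Av G v u c := by
      intro hc
      apply hac
      obtain ⟨w, hw⟩ := ha.symm.trans hc
      exact ⟨w, fun e he => by
        rintro rfl
        exact hw _ (w.snd_mem_support_of_mem_edges he) rfl⟩
    refine ⟨ha, s1 ha, (av_or hT huv c).resolve_right hc,
      (av_or hT huv d).resolve_right fun hd => hc (s2' hd), h1, h2⟩

theorem QE.swap {a b c d u v : V} (h : QE G a b c d u v) : QE G c d a b v u := by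
  obtain ⟨h1, h2, h3, h4, h5, h6⟩ := h
  exact ⟨h3, h4, h1, h2, h6, h5⟩

theorem QE.sl {a b c d u v : V} (h : QE G a b c d u v) : QE G b a c d u v := by
  obtain ⟨h1, h2, h3, h4, h5, h6⟩ := h
  exact ⟨h2, h1, h3, h4, fun h => h5 h.symm, h6⟩

theorem QE.sr {a b c d u v : V} (h : QE G a b c d u v) : QE G a b d c u v := h.swap.sl.swap

theorem QE.unique1 (hT : G.IsTree) {a b c d u v u' v' : V} (huv : G.Adj u v) (huv' : G.Adj u' v')
    (h : QE G a b c d u v) (h' : QE G a b c d u' v') : u = u' := by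
  have key : ∀ u v, G.Adj u v → QE G a b c d u v →
      ¬ Av G u a b ∧ ¬ Av G u a c ∧ ¬ Av G u b c := by
    rintro u v huv ⟨h1, h2, h3, h4, h5, h6⟩
    refine ⟨h5, fun h => ?_, fun h => ?_⟩
    · exact av_excl hT huv (h3.trans h.symm) h1
    · exact av_excl hT huv (h3.trans h.symm) h2
  obtain ⟨a1, a2, a3⟩ := key _ _ huv h
  obtain ⟨b1, b2, b3⟩ := key _ _ huv' h'
  exact median_unique hT b1 b2 b3 a1 a2 a3

theorem QE.unique (hT : G.IsTree) {a b c d u v u' v' : V} (huv : G.Adj u v) (huv' : G.Adj u' v')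
    (h : QE G a b c d u v) (h' : QE G a b c d u' v') : u = u' ∧ v = v' :=
  ⟨h.unique1 hT huv huv' h', h.swap.unique1 hT huv.symm huv'.symm h'.swap⟩

end tree

section recon

/-- A binary tree with leaves labelled bijectively. -/
structure LTr (G : SimpleGraph V) (l : X → V) : Prop where
  bt : IsBinaryTree G
  inj : Function.Injective l
  range : Set.range l = {v | IsLeaf G v}

/-- The displayed quartet relation on labels. -/
def DD (G : SimpleGraph V) (l : X → V) (a b c d : X) : Prop :=
  Displays G (l a) (l b) (l c) (l d)

/-- The label sets of the components at a vertex. -/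
def FF (G : SimpleGraph V) (l : X → V) (v : V) : Set (Set X) :=
  {A | ∃ a, G.Adj v a ∧ A = {x | Av G v a (l x)}}

def KK (D : X → X → X → X → Prop) (x y z : X) : Set (Set X) :=
  {{w | D x w y z}, {w | D y w x z}, {w | D z w x y}}

variable {G : SimpleGraph V} {l : X → V}

theorem LTr.leaf (h : LTr G l) (x : X) : IsLeaf G (l x) := by
  have : l x ∈ Set.range l := ⟨x, rfl⟩
  rwa [h.range] at this

theorem LTr.ex (h : LTr G l) {v : V} (hv : IsLeaf G v) : ∃ x, l x = v := by
  have : v ∈ Set.range l := by rw [h.range]; exact hv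
  exact this

theorem deg3_not_leaf {v : V} (h : IsDeg3 G v) : ¬ IsLeaf G v := by
  rintro ⟨n, hn, hu⟩
  obtain ⟨p, q, r, hpq, hpr, hqr, hp, hq, hr, -⟩ := h
  exact hpq ((hu p hp).trans (hu q hq).symm)

theorem LTr.deg3_ne (h : LTr G l) {v : V} (hv : IsDeg3 G v) (x : X) : l x ≠ v := by
  rintro rfl
  exact deg3_not_leaf hv (h.leaf x)

theorem LTr.exl [Finite V] (h : LTr G l) {u a : V} (hu : G.Adj u a) : ∃ x, Av G u a (l x) := by
  obtain ⟨v, hv, hv'⟩ := exists_leaf h.bt u a hu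
  obtain ⟨x, rfl⟩ := h.ex hv
  exact ⟨x, hv'⟩

theorem LTr.FF_leaf (h : LTr G l) (x : X) : FF G l (l x) = {{x}ᶜ} := by
  obtain ⟨n, hn, hu⟩ := id (h.leaf x)
  have key : {y | Av G (l x) n (l y)} = {x}ᶜ := by
    ext y
    constructor
    · intro hy hyx
      rw [Set.mem_singleton_iff] at hyx
      subst hyx
      exact hy.right rfl
    · intro hy
      exact leaf_av h.bt.1 (h.leaf x) hn.ne.symm (fun e => hy (h.inj e))
  ext A
  constructor
  · rintro ⟨a, ha, rfl⟩
    obtain rfl := hu a ha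
    exact key
  · rintro rfl
    exact ⟨n, hn, key.symm⟩

theorem LTr.med (h : LTr G l) {x y z : X} (hxy : x ≠ y) (hxz : x ≠ z) (hyz : y ≠ z) :
    ∃ v, IsDeg3 G v ∧ ¬ Av G v (l x) (l y) ∧ ¬ Av G v (l x) (l z) ∧ ¬ Av G v (l y) (l z) := by
  obtain ⟨v, h1, h2, h3⟩ := median_exists h.bt.1 (l x) (l y) (l z)
  refine ⟨v, (h.bt.2 v).resolve_left fun hv => ?_, h1, h2, h3⟩
  by_cases hx : l x = v
  · subst hx
    exact h3 (leaf_av h.bt.1 hv (fun e => hxy (h.inj e.symm)) (fun e => hxz (h.inj e.symm)))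
  by_cases hy : l y = v
  · subst hy
    exact h2 (leaf_av h.bt.1 hv hx (fun e => hyz (h.inj e.symm)))
  · exact h1 (leaf_av h.bt.1 hv hx hy)

theorem LTr.med' [Finite V] (h : LTr G l) {v : V} (hv : IsDeg3 G v) :
    ∃ x y z, x ≠ y ∧ x ≠ z ∧ y ≠ z ∧
      ¬ Av G v (l x) (l y) ∧ ¬ Av G v (l x) (l z) ∧ ¬ Av G v (l y) (l z) := by
  obtain ⟨p, q, r, hpq, hpr, hqr, hp, hq, hr, -⟩ := id hv
  obtain ⟨x, hx⟩ := h.exl hp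
  obtain ⟨y, hy⟩ := h.exl hq
  obtain ⟨z, hz⟩ := h.exl hr
  have h1 : ¬ Av G v (l x) (l y) := fun e =>
    hpq (av_nbr_eq h.bt.1 hp hq ((hx.trans e).trans hy.symm))
  have h2 : ¬ Av G v (l x) (l z) := fun e =>
    hpr (av_nbr_eq h.bt.1 hp hr ((hx.trans e).trans hz.symm))
  have h3 : ¬ Av G v (l y) (l z) := fun e =>
    hqr (av_nbr_eq h.bt.1 hq hr ((hy.trans e).trans hz.symm))
  refine ⟨x, y, z, ?_, ?_, ?_, h1, h2, h3⟩
  · rintro rfl; exact h1 (Av.rfl' hx.right)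
  · rintro rfl; exact h2 (Av.rfl' hx.right)
  · rintro rfl; exact h3 (Av.rfl' hy.right)

theorem LTr.side (h : LTr G l) {v a : V} (ha : G.Adj v a) {x y z : X}
    (hx : Av G v a (l x))
    (h1 : ¬ Av G v (l x) (l y)) (h2 : ¬ Av G v (l x) (l z)) (h3 : ¬ Av G v (l y) (l z)) :
    {w | Av G v a (l w)} = {w | DD G l x w y z} := by
  ext w
  constructor
  · intro hw
    refine disp_of_split h.bt.1 ha.symm hx hw ?_ ?_
    · exact (av_or h.bt.1 ha _).resolve_left fun e => h1 (hx.symm.trans e)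
    · exact (av_or h.bt.1 ha _).resolve_left fun e => h2 (hx.symm.trans e)
  · intro hw
    have := (disp_iff h.bt.1).1 hw v
    exact hx.trans (this.resolve_right h3)

theorem LTr.nbrs (h : LTr G l) {v : V} (hv : IsDeg3 G v) {x y z : X}
    (h1 : ¬ Av G v (l x) (l y)) (h2 : ¬ Av G v (l x) (l z)) (h3 : ¬ Av G v (l y) (l z)) :
    ∃ p q r, G.Adj v p ∧ G.Adj v q ∧ G.Adj v r ∧ Av G v p (l x) ∧ Av G v q (l y) ∧
      Av G v r (l z) ∧ ∀ a, G.Adj v a → a = p ∨ a = q ∨ a = r := by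
  obtain ⟨p, hp, kp⟩ := av_nbr h.bt.1 (h.deg3_ne hv x)
  obtain ⟨q, hq, kq⟩ := av_nbr h.bt.1 (h.deg3_ne hv y)
  obtain ⟨r, hr, kr⟩ := av_nbr h.bt.1 (h.deg3_ne hv z)
  refine ⟨p, q, r, hp, hq, hr, kp, kq, kr, ?_⟩
  have npq : p ≠ q := by rintro rfl; exact h1 (kp.symm.trans kq)
  have npr : p ≠ r := by rintro rfl; exact h2 (kp.symm.trans kr)
  have nqr : q ≠ r := by rintro rfl; exact h3 (kq.symm.trans kr)
  obtain ⟨a, b, c, hab, hac, hbc, ha, hb, hc, hall⟩ := hv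
  intro t ht
  have := hall p hp
  have := hall q hq
  have := hall r hr
  have := hall t ht
  grind

theorem LTr.FF_deg3 (h : LTr G l) {v : V} (hv : IsDeg3 G v) {x y z : X}
    (h1 : ¬ Av G v (l x) (l y)) (h2 : ¬ Av G v (l x) (l z)) (h3 : ¬ Av G v (l y) (l z)) :
    FF G l v = KK (DD G l) x y z := by
  obtain ⟨p, q, r, hp, hq, hr, kp, kq, kr, hall⟩ := h.nbrs hv h1 h2 h3
  have e1 := h.side hp kp h1 h2 h3
  have e2 := h.side hq kq (fun e => h1 e.symm) h3 h2
  have e3 := h.side hr kr (fun e => h2 e.symm) (fun e => h3 e.symm) h1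
  ext A
  unfold KK
  rw [← e1, ← e2, ← e3]
  constructor
  · rintro ⟨a, ha, rfl⟩
    rcases hall a ha with rfl | rfl | rfl <;> simp
  · rintro (rfl | rfl | rfl)
    · exact ⟨p, hp, rfl⟩
    · exact ⟨q, hq, rfl⟩
    · exact ⟨r, hr, rfl⟩

theorem LTr.total (h : LTr G l) {a b c d : X} (hab : a ≠ b) (hac : a ≠ c) (had : a ≠ d)
    (hbc : b ≠ c) (hbd : b ≠ d) (hcd : c ≠ d) :
    DD G l a b c d ∨ DD G l a c b d ∨ DD G l a d b c := by
  obtain ⟨v, hv, h1, h2, h3⟩ := h.med hab hac hbc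
  obtain ⟨p, q, r, hp, hq, hr, kp, kq, kr, hall⟩ := h.nbrs hv h1 h2 h3
  obtain ⟨t, ht, kt⟩ := av_nbr h.bt.1 (h.deg3_ne hv d)
  rcases hall t ht with rfl | rfl | rfl
  · have e := h.side hp kp h1 h2 h3
    have : d ∈ {w | Av G v t (l w)} := kt
    rw [e] at this
    exact Or.inr (Or.inr this)
  · have e := h.side hq kq (fun e => h1 e.symm) h3 h2
    have : d ∈ {w | Av G v t (l w)} := kt
    rw [e] at this
    exact Or.inr (Or.inl (disp_comm this))
  · have e := h.side hr kr (fun e => h2 e.symm) (fun e => h3 e.symm) h1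
    have : d ∈ {w | Av G v t (l w)} := kt
    rw [e] at this
    exact Or.inl (disp_comm this)

theorem LTr.FF_inj [Finite V] (h : LTr G l) : Function.Injective (FF G l) := by
  have key : ∀ u v, IsDeg3 G u → IsLeaf G v → FF G l u ≠ FF G l v := by
    intro u v hu hv e
    obtain ⟨x, rfl⟩ := h.ex hv
    rw [h.FF_leaf] at e
    obtain ⟨p, q, r, hpq, hpr, hqr, hp, hq, hr, -⟩ := id hu
    have e1 : {x | Av G u p (l x)} ∈ FF G l u := ⟨p, hp, rfl⟩
    have e2 : {x | Av G u q (l x)} ∈ FF G l u := ⟨q, hq, rfl⟩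
    rw [e, Set.mem_singleton_iff] at e1 e2
    obtain ⟨y, hy⟩ := h.exl hp
    have : y ∈ {x | Av G u q (l x)} := by
      rw [e2, ← e1]; exact hy
    exact hpq (av_nbr_eq h.bt.1 hp hq (hy.trans this.symm))
  intro u v e
  rcases h.bt.2 u with hu | hu
  · rcases h.bt.2 v with hv | hv
    · obtain ⟨x, rfl⟩ := h.ex hu
      obtain ⟨y, rfl⟩ := h.ex hv
      rw [h.FF_leaf, h.FF_leaf] at e
      have := compl_injective (Set.singleton_injective e)
      rw [Set.singleton_injective this]
    · exact absurd e.symm (key _ _ hv hu)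
  · rcases h.bt.2 v with hv | hv
    · exact absurd e (key _ _ hu hv)
    · obtain ⟨x, y, z, -, -, -, h1, h2, h3⟩ := h.med' hu
      obtain ⟨p, q, r, hp, hq, hr, kp, kq, kr, hall⟩ := h.nbrs hu h1 h2 h3
      have main : ∀ x y, ¬ Av G u (l x) (l y) → ¬ Av G v (l x) (l y) := by
        intro x y hxy hv'
        obtain ⟨a, ha, ka⟩ := av_nbr h.bt.1 hv'.left
        have : {x | Av G v a (l x)} ∈ FF G l v := ⟨a, ha, rfl⟩
        rw [← e] at this
        obtain ⟨b, hb, eb⟩ := this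
        have m1 : x ∈ {x | Av G v a (l x)} := ka
        have m2 : y ∈ {x | Av G v a (l x)} := ka.trans hv'
        rw [eb] at m1 m2
        exact hxy (m1.symm.trans m2)
      exact median_unique h.bt.1 (main _ _ h1) (main _ _ h2) (main _ _ h3) h1 h2 h3

theorem LTr.adj_iff [Finite V] (h : LTr G l) (hX : Nonempty X) {u v : V} :
    G.Adj u v ↔ ∃ A ∈ FF G l u, Aᶜ ∈ FF G l v := by
  have hT := h.bt.1
  constructor
  · intro huv
    refine ⟨_, ⟨v, huv, rfl⟩, u, huv.symm, ?_⟩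
    ext x
    constructor
    · intro hx
      exact (av_or hT huv _).resolve_left hx
    · intro hx hx'
      exact av_excl hT huv hx' hx
  · rintro ⟨A, ⟨a, ha, rfl⟩, b, hb, e⟩
    have e' : ∀ x, Av G v b (l x) ↔ ¬ Av G u a (l x) := by
      intro x
      have := Set.ext_iff.1 e x
      exact this.symm
    have third : ∀ u a b, G.Adj u a → G.Adj u b → a ≠ b →
        ∃ c, G.Adj u c ∧ c ≠ a ∧ c ≠ b := by
      intro u a b ha hb hab
      rcases h.bt.2 u with ⟨n, hn, hu⟩ | ⟨p, q, r, hpq, hpr, hqr, hp, hq, hr, -⟩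
      · exact absurd ((hu a ha).trans (hu b hb).symm) hab
      · by_contra hcon
        have k := fun t ht h1 h2 => hcon ⟨t, ht, h1, h2⟩
        have k1 := k p hp
        have k2 := k q hq
        have k3 := k r hr
        grind
    have huv : u ≠ v := by
      rintro rfl
      have hab : a ≠ b := by
        rintro rfl
        obtain ⟨x⟩ := hX
        have := e' x
        tauto
      obtain ⟨c, hc, hca, hcb⟩ := third u a b ha hb hab
      obtain ⟨x, hx⟩ := h.exl hc
      have h1 : ¬ Av G u a (l x) := fun k => hca (av_nbr_eq hT hc ha (hx.trans k.symm))
      have h2 := (e' x).2 h1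
      exact hcb (av_nbr_eq hT hc hb (hx.trans h2.symm))
    -- u lies towards b as seen from v, generic claim
    have claim : ∀ u v a b, G.Adj u a → G.Adj v b → u ≠ v →
        (∀ x, Av G v b (l x) ↔ ¬ Av G u a (l x)) → Av G u a v := by
      intro u v a b ha hb huv e'
      by_contra hcon
      obtain ⟨p, hp, kp⟩ := av_nbr hT huv.symm
      have hpa : p ≠ a := by rintro rfl; exact hcon kp
      obtain ⟨q, hq, hqp, hqa⟩ := third u p a hp ha hpa
      obtain ⟨y, hy⟩ := h.exl hq
      have h1 : ¬ Av G u a (l y) := fun k => hqa (av_nbr_eq hT hq ha (hy.trans k.symm))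
      have h2 := (e' y).2 h1
      have h3 : Av G v u (l y) := by
        apply av_anti hT huv
        intro k
        exact hqp (av_nbr_eq hT hq hp ((hy.trans k.symm).trans kp.symm))
      have h4 : Av G v b u := h2.trans h3.symm
      obtain ⟨z, hz⟩ := h.exl ha
      have h5 : Av G v u (l z) := by
        apply av_anti hT huv
        intro k
        exact hcon (hz.trans k.symm)
      exact (e' z).1 (h4.trans h5) hz
    have c1 := claim u v a b ha hb huv e'
    have c2 := claim v u b a hb ha huv.symm (fun x => by rw [e']; tauto)
    by_cases hav : a = v
    · subst hav; exact ha
    exfalso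
    obtain ⟨c, hc, kc⟩ := av_nbr hT (Ne.symm hav)
    have hcu : c ≠ u := by
      rintro rfl
      exact av_excl hT ha c1 kc
    obtain ⟨t, ht, htc, htu⟩ := third a c u hc ha.symm hcu
    obtain ⟨x, hx⟩ := h.exl ht
    have h1 : Av G u a (l x) := by
      refine (av_or hT ha _).resolve_right fun k => htu ?_
      exact av_nbr_eq hT ht ha.symm (hx.trans k.symm)
    have h2 : Av G v a (l x) := by
      apply av_anti hT hav
      intro k
      exact htc (av_nbr_eq hT ht hc ((hx.trans k.symm).trans kc.symm))
    have h3 : Av G v u a := Av.adj ha huv hav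
    exact (e' x).1 (c2.trans (h3.trans h2)) h1

theorem recon {W : Type*} [Finite V] [Finite W] {H : SimpleGraph W} {m : X → W}
    (h : LTr G l) (h' : LTr H m) (hX : Nonempty X)
    (hD : DD G l = DD H m) : ∃ φ : G ≃g H, ∀ x, φ (l x) = m x := by
  have hr : Set.range (FF G l) = Set.range (FF H m) := by
    apply Set.Subset.antisymm
    · rintro _ ⟨v, rfl⟩
      rcases h.bt.2 v with hv | hv
      · obtain ⟨x, rfl⟩ := h.ex hv
        exact ⟨m x, by rw [h.FF_leaf, h'.FF_leaf]⟩
      · obtain ⟨x, y, z, n1, n2, n3, h1, h2, h3⟩ := h.med' hv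
        obtain ⟨w, hw, k1, k2, k3⟩ := h'.med n1 n2 n3
        exact ⟨w, by rw [h.FF_deg3 hv h1 h2 h3, h'.FF_deg3 hw k1 k2 k3, hD]⟩
    · rintro _ ⟨v, rfl⟩
      rcases h'.bt.2 v with hv | hv
      · obtain ⟨x, rfl⟩ := h'.ex hv
        exact ⟨l x, by rw [h.FF_leaf, h'.FF_leaf]⟩
      · obtain ⟨x, y, z, n1, n2, n3, h1, h2, h3⟩ := h'.med' hv
        obtain ⟨w, hw, k1, k2, k3⟩ := h.med n1 n2 n3
        exact ⟨w, by rw [h'.FF_deg3 hv h1 h2 h3, h.FF_deg3 hw k1 k2 k3, hD]⟩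
  have ex : ∀ v, ∃ w, FF H m w = FF G l v := fun v => by
    have : FF G l v ∈ Set.range (FF H m) := hr ▸ ⟨v, rfl⟩
    exact this
  choose f hf using ex
  have bij : Function.Bijective f := by
    constructor
    · intro u v e
      apply h.FF_inj
      rw [← hf, ← hf, e]
    · intro w
      have : FF H m w ∈ Set.range (FF G l) := hr ▸ ⟨w, rfl⟩
      obtain ⟨v, hv⟩ := this
      exact ⟨v, h'.FF_inj (by rw [hf, hv])⟩
  refine ⟨⟨Equiv.ofBijective f bij, ?_⟩, ?_⟩
  · intro u v
    change H.Adj (f u) (f v) ↔ G.Adj u v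
    rw [h.adj_iff hX, h'.adj_iff hX, hf, hf]
  · intro x
    change f (l x) = m x
    apply h'.FF_inj
    rw [hf, h.FF_leaf, h'.FF_leaf]

end recon

section main

variable {G : SimpleGraph V} {l : X → V} {W : Type*} {H : SimpleGraph W} {m : X → W}

theorem step (h : LTr G l) (h' : LTr H m) {Y : Set X} {z d a c : X}
    (hI : ∀ p ∈ Y, ∀ q ∈ Y, ∀ r ∈ Y, ∀ s ∈ Y, DD G l p q r s → DD H m p q r s)
    (hd : d ∈ Y) (ha : a ∈ Y) (hc : c ∈ Y) (had : a ≠ d) (hcd : c ≠ d) (hac : a ≠ c)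
    (h2 : ∀ y ∈ Y, ∀ y' ∈ Y, y ≠ d → y' ≠ d → DD G l y y' d z)
    (h3 : ∀ y ∈ Y, y ≠ d → ¬ DD G l a c d y)
    (h4 : DD H m a c d z) :
    ∀ p ∈ insert z Y, ∀ q ∈ insert z Y, ∀ r ∈ insert z Y, ∀ s ∈ insert z Y,
      DD G l p q r s → DD H m p q r s := by
  have hT := h.bt.1
  have hT' := h'.bt.1
  have n3 : ∀ y ∈ Y, y ≠ d → ¬ DD H m a c d y := by
    intro y hy hyd hD
    have hya : a ≠ y := by
      rintro rfl; exact disp_ne hT' (disp_sr hD) rfl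
    have hyc : c ≠ y := by
      rintro rfl; exact disp_ne hT' (disp_sl (disp_sr hD)) rfl
    rcases h.total hac had hya hcd hyc hyd.symm with k | k | k
    · exact h3 y hy hyd k
    · exact disp_excl hT' hD (hI _ ha _ hd _ hc _ hy k)
    · exact disp_excl hT' (disp_sr hD) (disp_sr (hI _ ha _ hy _ hc _ hd k) |> disp_sr)
  have d1 : ∀ y ∈ Y, y ≠ d → DD H m a y d z := by
    intro y hy hyd
    rcases disp_five hT' h4 (m y) with k | k
    · exact absurd k.1 (n3 y hy hyd)
    · exact k.1
  have d2 : ∀ y ∈ Y, ∀ y' ∈ Y, y ≠ d → y' ≠ d → DD H m y y' d z := by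
    intro y hy y' hy' n n'
    exact disp_trans hT' (d1 y hy n) (d1 y' hy' n')
  have key : ∀ p ∈ Y, ∀ q ∈ Y, ∀ r ∈ Y, DD G l p q r z → DD H m p q r z := by
    intro p hp q hq r hr hD
    have npr : p ≠ r := by rintro rfl; exact disp_ne hT hD rfl
    have nqr : q ≠ r := by rintro rfl; exact disp_ne hT (disp_sl hD) rfl
    by_cases hr' : r = d
    · subst hr'
      exact d2 p hp q hq npr nqr
    by_cases hp' : p = d
    · subst hp'
      by_cases hq' : q = p
      · subst hq'
        have nz : q ≠ z := by rintro rfl; exact disp_ne hT (disp_sr hD) rfl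
        refine disp_self hT' (h'.leaf _) ?_ ?_
        · exact fun e => npr (h'.inj e.symm)
        · exact fun e => nz (h'.inj e.symm)
      · exfalso
        have := h2 q hq r hr hq' hr'
        exact disp_excl hT (disp_comm this) (disp_sr hD)
    by_cases hq' : q = d
    · subst hq'
      exfalso
      have := h2 p hp r hr hp' hr'
      exact disp_excl hT (disp_comm this) (disp_sr (disp_sl hD))
    have e1 : DD G l p q r d := by
      rcases disp_five hT hD (l d) with k | k
      · exact k.1
      · exfalso
        exact disp_excl hT (h2 p hp r hr hp' hr') k.1
    have e2 := hI _ hp _ hq _ hr _ hd e1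
    rcases disp_five hT' e2 (m z) with k | k
    · exact k.1
    · exfalso
      exact disp_excl hT' (disp_sr (d2 p hp r hr hp' hr')) k.1
  have keyz : ∀ r s, DD G l z z r s → DD H m z z r s := by
    intro r s hD
    refine disp_self hT' (h'.leaf _) ?_ ?_
    · exact fun e => disp_ne hT hD (by rw [h'.inj e])
    · exact fun e => disp_ne hT (disp_sr hD) (by rw [h'.inj e])
  rintro p (rfl | hp) q (rfl | hq) r (rfl | hr) s (rfl | hs) hD
  all_goals first
    | exact hI _ hp _ hq _ hr _ hs hD
    | exact keyz _ _ hD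
    | exact disp_comm (keyz _ _ (disp_comm hD))
    | exact absurd rfl (disp_ne hT hD)
    | exact absurd rfl (disp_ne hT (disp_sl hD))
    | exact absurd rfl (disp_ne hT (disp_sr hD))
    | exact absurd rfl (disp_ne hT (disp_sl (disp_sr hD)))
    | exact key _ hp _ hq _ hr hD
    | exact disp_sr (key _ hp _ hq _ hs (disp_sr hD))
    | exact disp_comm (key _ hr _ hs _ hp (disp_comm hD))
    | exact disp_comm (disp_sr (key _ hr _ hs _ hq (disp_sr (disp_comm hD))))

theorem qe_of (hT : G.IsTree) {q : Sym2 (Sym2 X)} {u v : V} (hadj : G.Adj u v)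
    (h : QDist G l q u v ∨ QDist G l q v u) :
    ∃ a b c d, q = s(s(a, b), s(c, d)) ∧ QE G (l a) (l b) (l c) (l d) u v := by
  rcases h with ⟨a, b, c, d, rfl, h⟩ | ⟨a, b, c, d, rfl, h⟩
  · exact ⟨a, b, c, d, rfl, QE_of_distPath hT hadj h⟩
  · exact ⟨c, d, a, b, Sym2.eq_swap, (QE_of_distPath hT hadj.symm h).swap⟩

theorem q_cases {P : X → X → X → X → Prop} (p1 : ∀ a b c d, P a b c d → P b a c d)
    (p2 : ∀ a b c d, P a b c d → P a b d c) {a b c d a' b' c' d' : X}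
    (e : s(s(a, b), s(c, d)) = s(s(a', b'), s(c', d'))) (h : P a b c d) :
    P a' b' c' d' ∨ P c' d' a' b' := by
  rw [Sym2.eq_iff] at e
  rcases e with ⟨e1, e2⟩ | ⟨e1, e2⟩ <;> rw [Sym2.eq_iff] at e1 e2
  · left
    rcases e1 with ⟨rfl, rfl⟩ | ⟨rfl, rfl⟩ <;> rcases e2 with ⟨rfl, rfl⟩ | ⟨rfl, rfl⟩
    · exact h
    · exact p2 _ _ _ _ h
    · exact p1 _ _ _ _ h
    · exact p1 _ _ _ _ (p2 _ _ _ _ h)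
  · right
    rcases e1 with ⟨rfl, rfl⟩ | ⟨rfl, rfl⟩ <;> rcases e2 with ⟨rfl, rfl⟩ | ⟨rfl, rfl⟩
    · exact h
    · exact p2 _ _ _ _ h
    · exact p1 _ _ _ _ h
    · exact p1 _ _ _ _ (p2 _ _ _ _ h)

theorem qd_unique (hT : G.IsTree) {q : Sym2 (Sym2 X)} {u v u' v' : V} (hadj : G.Adj u v)
    (hadj' : G.Adj u' v')
    (h : QDist G l q u v ∨ QDist G l q v u) (h' : QDist G l q u' v' ∨ QDist G l q v' u') :
    u = u' ∨ u = v' := by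
  obtain ⟨a, b, c, d, e, h⟩ := qe_of hT hadj h
  obtain ⟨a', b', c', d', e', h'⟩ := qe_of hT hadj' h'
  rcases q_cases (P := fun a b c d => QE G (l a) (l b) (l c) (l d) u v)
    (fun _ _ _ _ h => h.sl) (fun _ _ _ _ h => h.sr) (e.symm.trans e') h with k | k
  · exact Or.inl (k.unique hT hadj hadj' h').1
  · exact Or.inr (k.unique hT hadj hadj'.symm h'.swap).1

theorem dd_of {a b c d : X} (h : DisplaysQ H m s(s(a, b), s(c, d))) : DD H m a b c d := by
  obtain ⟨a', b', c', d', -, -, -, -, -, -, e, h⟩ := h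
  rcases q_cases (P := DD H m)
    (fun _ _ _ _ h => disp_sl h) (fun _ _ _ _ h => disp_sr h) e.symm h with k | k
  · exact k
  · exact disp_comm k

theorem dq_ne {a b c d : X} (h : DisplaysQ H m s(s(a, b), s(c, d))) :
    a ≠ b ∧ a ≠ c ∧ a ≠ d ∧ b ≠ c ∧ b ≠ d ∧ c ≠ d := by
  obtain ⟨a', b', c', d', h1, h2, h3, h4, h5, h6, e, h⟩ := h
  rcases q_cases (P := fun a b c d : X => a ≠ b ∧ a ≠ c ∧ a ≠ d ∧ b ≠ c ∧ b ≠ d ∧ c ≠ d)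
    (fun _ _ _ _ h => by grind) (fun _ _ _ _ h => by grind) e.symm
    ⟨h1, h2, h3, h4, h5, h6⟩ with k | k <;> grind

theorem suppQ_mk (a b c d : X) : suppQ s(s(a, b), s(c, d)) = {a, b, c, d} := by
  ext x
  simp [suppQ, or_assoc]

theorem suppQ_card {q : Sym2 (Sym2 X)} (h : DisplaysQ G l q) : (suppQ q).ncard = 4 := by
  obtain ⟨a, b, c, d, h1, h2, h3, h4, h5, h6, rfl, -⟩ := h
  rw [suppQ_mk]
  rw [Set.ncard_insert_of_notMem (by simp [h1, h2, h3]),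
    Set.ncard_insert_of_notMem (by simp [h4, h5]), Set.ncard_pair h6]

theorem link_extract (hT : G.IsTree) (hinj : Function.Injective l)
    {q1 q2 : Sym2 (Sym2 X)}
    (hq1 : DisplaysQ G l q1) (hq2 : DisplaysQ G l q2) {u v w : V} (huw : u ≠ w) (huv : G.Adj u v) (hvw : G.Adj v w)
    (h1 : QDist G l q1 u v ∨ QDist G l q1 v u)
    (h2 : QDist G l q2 v w ∨ QDist G l q2 w v)
    (h5 : (suppQ q1 ∪ suppQ q2).ncard = 5) :
    ∃ a c d z, q2 = s(s(a, c), s(d, z)) ∧ a ∈ suppQ q1 ∧ c ∈ suppQ q1 ∧ d ∈ suppQ q1 ∧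
      QE G (l a) (l c) (l d) (l z) v w := by
  have h4 := suppQ_card hq1
  obtain ⟨a, b, c, d, e1, k1⟩ := qe_of hT huv h1
  obtain ⟨e, f, g, h, e2, k2⟩ := qe_of hT hvw h2
  have s1 : suppQ q1 = {a, b, c, d} := by rw [e1, suppQ_mk]
  have hfin : (suppQ q1 ∪ suppQ q2).Finite := Set.finite_of_ncard_ne_zero (by omega)
  have hone : ∀ s ∈ suppQ q2, ∀ t ∈ suppQ q2, s ∉ suppQ q1 → t ∉ suppQ q1 → s = t := by
    intro s hs t ht hs' ht'
    by_contra hst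
    have : (insert s (insert t (suppQ q1))).ncard = 6 := by
      rw [Set.ncard_insert_of_notMem _ ((hfin.subset Set.subset_union_left).insert _),
        Set.ncard_insert_of_notMem ht' (hfin.subset Set.subset_union_left), h4]
      simp [hst, hs']
    have h6 : (insert s (insert t (suppQ q1))).ncard ≤ (suppQ q1 ∪ suppQ q2).ncard := by
      apply Set.ncard_le_ncard _ hfin
      intro x hx
      rcases hx with rfl | rfl | hx
      · exact Or.inr hs
      · exact Or.inr ht
      · exact Or.inl hx
    omega
  obtain ⟨a1, a2, a3, a4, a5, a6⟩ := k1
  obtain ⟨b1, b2, b3, b4, b5, b6⟩ := id k2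
  have hside : ∀ x ∈ suppQ q1, ∀ y ∈ suppQ q1, Av G v w (l x) → Av G v w (l y) →
      l x = l y := by
    have nu : ∀ x, Av G v u x → ¬ Av G v w x := fun x hx hx' =>
      huw (av_nbr_eq hT huv.symm hvw (hx.trans hx'.symm))
    rw [s1]
    rintro x (rfl | rfl | rfl | rfl) y (rfl | rfl | rfl | rfl) hx hy
    all_goals first
      | rfl
      | exact absurd hx (nu _ a1)
      | exact absurd hx (nu _ a2)
      | exact absurd hy (nu _ a1)
      | exact absurd hy (nu _ a2)
      | exact absurd (hx.symm.trans hy) a6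
      | exact absurd (hy.symm.trans hx) a6
  have s2 : suppQ q2 = {e, f, g, h} := by rw [e2, suppQ_mk]
  have hgh : ¬ (g ∈ suppQ q1 ∧ h ∈ suppQ q1) := by
    rintro ⟨hg, hh⟩
    exact (dq_ne (e2 ▸ hq2)).2.2.2.2.2 (hinj (hside g hg h hh b3 b4))
  obtain ⟨d1, d2, d3, d4, d5, d6⟩ := dq_ne (e2 ▸ hq2)
  have me : e ∈ suppQ q2 := by rw [s2]; simp
  have mf : f ∈ suppQ q2 := by rw [s2]; simp
  have mg : g ∈ suppQ q2 := by rw [s2]; simp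
  have mh : h ∈ suppQ q2 := by rw [s2]; simp
  by_cases hg : g ∈ suppQ q1
  · have hh : h ∉ suppQ q1 := fun hh => hgh ⟨hg, hh⟩
    exact ⟨e, f, g, h, e2, by_contra fun k => d3 (hone _ me _ mh k hh),
      by_contra fun k => d5 (hone _ mf _ mh k hh), hg, k2⟩
  · exact ⟨e, f, h, g, e2.trans (by rw [Sym2.eq_swap (a := g)]),
      by_contra fun k => d2 (hone _ me _ mg k hg),
      by_contra fun k => d4 (hone _ mf _ mg k hg),
      by_contra fun k => d6 (hone _ mg _ mh hg k), k2.sr⟩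

/-- The set of edges distinguished by quartets of `S`. -/
def EE (G : SimpleGraph V) (l : X → V) (S : Set (Sym2 (Sym2 X))) (x y : V) : Prop :=
  ∃ q ∈ S, QDist G l q x y ∨ QDist G l q y x

def YY (S : Set (Sym2 (Sym2 X))) : Set X := {x | ∃ q ∈ S, x ∈ suppQ q}

structure InvT (G : SimpleGraph V) (l : X → V) (H : SimpleGraph W) (m : X → W)
    (S : Set (Sym2 (Sym2 X))) (U : Set V) : Prop where
  card : (YY S).ncard = S.ncard + 3
  imp : ∀ p ∈ YY S, ∀ q ∈ YY S, ∀ r ∈ YY S, ∀ s ∈ YY S, DD G l p q r s → DD H m p q r s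
  mem : ∀ q ∈ S, ∀ x y, G.Adj x y → (QDist G l q x y ∨ QDist G l q y x) → x ∈ U
  one : ∀ x ∈ U, ∀ y, G.Adj x y → ¬ EE G l S x y → ∀ s ∈ YY S, ∀ t ∈ YY S,
    Av G x y (l s) → Av G x y (l t) → s = t
  out : ∀ x ∈ U, ∀ y, G.Adj x y → ¬ EE G l S x y → ∀ t ∈ U, ¬ Av G x y t

theorem InvT.base (h : LTr G l) (h' : LTr H m) {q : Sym2 (Sym2 X)}
    (hq : DisplaysQ G l q) (hq' : DisplaysQ H m q) {u v : V} (huv : G.Adj u v)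
    (hd : QDist G l q u v) : InvT G l H m {q} {u, v} := by
  have hT := h.bt.1
  have hY : YY {q} = suppQ q := by ext x; simp [YY]
  have hE : ∀ x y, ¬ EE G l {q} x y → ¬ (QDist G l q x y ∨ QDist G l q y x) :=
    fun x y hn k => hn ⟨q, rfl, k⟩
  refine ⟨?_, ?_, ?_, ?_, ?_⟩
  · rw [hY, suppQ_card hq]; simp
  · obtain ⟨a, b, c, d, e, k⟩ := qe_of hT huv (Or.inl hd)
    subst e
    obtain ⟨d1, d2, d3, d4, d5, d6⟩ := dq_ne hq
    have hD := dd_of hq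
    have hD' := dd_of hq'
    have hs := step h h' (Y := {a, b, c}) (z := d) (d := c) (a := a) (c := b) ?_ (by simp)
      (by simp) (by simp) d2 d4 d1 ?_ ?_ hD'
    · rw [hY, suppQ_mk]
      have : ({a, b, c, d} : Set X) = insert d {a, b, c} := by
        ext x; simp; tauto
      rw [this]
      exact hs
    · have ne : ∀ p q r s, DD G l p q r s → p ≠ r ∧ p ≠ s ∧ q ≠ r ∧ q ≠ s := by
        intro p q r s k
        refine ⟨?_, ?_, ?_, ?_⟩ <;> rintro rfl
        · exact disp_ne hT k rfl
        · exact disp_ne hT (disp_sr k) rfl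
        · exact disp_ne hT (disp_sl k) rfl
        · exact disp_ne hT (disp_sl (disp_sr k)) rfl
      intro p hp q hq r hr s hs k
      obtain ⟨n1, n2, n3, n4⟩ := ne p q r s k
      by_cases hpq : p = q
      · subst hpq
        exact disp_self h'.bt.1 (h'.leaf _) (fun e => n1 (h'.inj e.symm))
          (fun e => n2 (h'.inj e.symm))
      by_cases hrs : r = s
      · subst hrs
        exact disp_comm (disp_self h'.bt.1 (h'.leaf _) (fun e => n1 (h'.inj e))
          (fun e => n3 (h'.inj e)))
      exfalso
      simp only [Set.mem_insert_iff, Set.mem_singleton_iff] at hp hq hr hs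
      grind
    · have self : ∀ y, y ≠ c → y ≠ d → DD G l y y c d := fun y n n' =>
        disp_self hT (h.leaf _) (fun e => n (h.inj e.symm)) (fun e => n' (h.inj e.symm))
      rintro y (rfl | rfl | rfl) y' (rfl | rfl | rfl) n n'
      all_goals first
        | exact absurd rfl n
        | exact absurd rfl n'
        | exact hD
        | exact disp_sl hD
        | exact self _ d2 d3
        | exact self _ d4 d5
    · rintro y (rfl | rfl | rfl) n k
      · exact disp_ne hT (disp_sr k) rfl
      · exact disp_ne hT (disp_sl (disp_sr k)) rfl
      · exact n rfl
  · rintro q' rfl x y hxy k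
    exact qd_unique hT hxy huv k (Or.inl hd)
  · have key : ∀ u v, G.Adj u v → (QDist G l q u v ∨ QDist G l q v u) → ∀ y, G.Adj u y →
        ¬ EE G l {q} u y → ∀ s ∈ YY {q}, ∀ t ∈ YY {q},
        Av G u y (l s) → Av G u y (l t) → s = t := by
      intro u v huv hd y hy hn
      have hyv : y ≠ v := by rintro rfl; exact hE _ _ hn hd
      obtain ⟨a, b, c, d, e, a1, a2, a3, a4, a5, a6⟩ := qe_of hT huv hd
      rw [hY, e, suppQ_mk]
      have nv : ∀ x, Av G u v x → ¬ Av G u y x := fun x hx hx' =>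
        hyv (av_nbr_eq hT hy huv (hx'.trans hx.symm))
      rintro s (rfl | rfl | rfl | rfl) t (rfl | rfl | rfl | rfl) hs ht
      all_goals first
        | rfl
        | exact absurd hs (nv _ a3)
        | exact absurd hs (nv _ a4)
        | exact absurd ht (nv _ a3)
        | exact absurd ht (nv _ a4)
        | exact absurd (hs.symm.trans ht) a5
        | exact absurd (ht.symm.trans hs) a5
    rintro x (rfl | rfl)
    · exact key _ _ huv (Or.inl hd)
    · exact key _ _ huv.symm (Or.inr hd)
  · have key : ∀ u v, G.Adj u v → (QDist G l q u v ∨ QDist G l q v u) → ∀ y, G.Adj u y →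
        ¬ EE G l {q} u y → ¬ Av G u y u ∧ ¬ Av G u y v := by
      intro u v huv hd y hy hn
      have hyv : y ≠ v := by rintro rfl; exact hE _ _ hn hd
      exact ⟨fun k => k.right rfl, fun k => hyv (av_nbr_eq hT hy huv k)⟩
    rintro x (rfl | rfl) y hy hn t (rfl | rfl)
    · exact (key _ _ huv (Or.inl hd) y hy hn).1
    · exact (key _ _ huv (Or.inl hd) y hy hn).2
    · exact (key _ _ huv.symm (Or.inr hd) y hy hn).2
    · exact (key _ _ huv.symm (Or.inr hd) y hy hn).1

theorem InvT.extend [Finite X] (h : LTr G l) (h' : LTr H m) {S : Set (Sym2 (Sym2 X))} {U : Set V}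
    (hI : InvT G l H m S U) {q1 q2 : Sym2 (Sym2 X)} (hq1S : q1 ∈ S) (hq2S : q2 ∉ S)
    (hq1 : DisplaysQ G l q1) (hq2 : DisplaysQ G l q2) (hq2' : DisplaysQ H m q2)
    {u v w : V} (huw : u ≠ w) (huv : G.Adj u v) (hvw : G.Adj v w)
    (h1 : QDist G l q1 u v ∨ QDist G l q1 v u)
    (h2 : QDist G l q2 v w ∨ QDist G l q2 w v)
    (h5 : (suppQ q1 ∪ suppQ q2).ncard = 5)
    (hnE : ¬ EE G l S v w) : InvT G l H m (insert q2 S) (insert w U) := by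
  have hT := h.bt.1
  obtain ⟨a, c, d, z, e2, ma, mc, md, k⟩ :=
    link_extract hT h.inj hq1 hq2 huw huv hvw h1 h2 h5
  obtain ⟨k1, k2, k3, k4, k5, k6⟩ := k
  obtain ⟨d1, d2, d3, d4, d5, d6⟩ := dq_ne (e2 ▸ hq2)
  have hvU : v ∈ U := hI.mem q1 hq1S v u huv.symm h1.symm
  have Ya : a ∈ YY S := ⟨q1, hq1S, ma⟩
  have Yc : c ∈ YY S := ⟨q1, hq1S, mc⟩
  have Yd : d ∈ YY S := ⟨q1, hq1S, md⟩
  have hone := hI.one v hvU w hvw hnE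
  have hout := hI.out v hvU w hvw hnE
  have Yz : z ∉ YY S := fun Yz => d6 (hone _ Yd _ Yz k3 k4)
  have hY : YY (insert q2 S) = insert z (YY S) := by
    have s2 : suppQ q2 = {a, c, d, z} := by rw [e2, suppQ_mk]
    ext x
    constructor
    · rintro ⟨q, rfl | hq, hx⟩
      · rw [s2] at hx
        rcases hx with rfl | rfl | rfl | rfl
        · exact Or.inr Ya
        · exact Or.inr Yc
        · exact Or.inr Yd
        · exact Or.inl rfl
      · exact Or.inr ⟨q, hq, hx⟩
    · rintro (rfl | ⟨q, hq, hx⟩)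
      · exact ⟨q2, Or.inl rfl, by rw [s2]; simp⟩
      · exact ⟨q, Or.inr hq, hx⟩
  have hns : ∀ y ∈ YY S, y ≠ d → ¬ Av G v w (l y) := fun y hy n k =>
    n (hone _ hy _ Yd k k3)
  have hE' : ∀ x y, ¬ EE G l (insert q2 S) x y → ¬ EE G l S x y := by
    rintro x y hn ⟨q, hq, hh⟩
    exact hn ⟨q, Or.inr hq, hh⟩
  have hEvw : EE G l (insert q2 S) v w := ⟨q2, Or.inl rfl, h2⟩
  have hEwv : EE G l (insert q2 S) w v := ⟨q2, Or.inl rfl, h2.symm⟩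
  refine ⟨?_, ?_, ?_, ?_, ?_⟩
  · rw [hY, Set.ncard_insert_of_notMem Yz (Set.toFinite _), hI.card,
      Set.ncard_insert_of_notMem hq2S (Set.toFinite _)]
  · rw [hY]
    refine step h h' hI.imp Yd Ya Yc d2 d4 d1 ?_ ?_ (dd_of (e2 ▸ hq2'))
    · intro y hy y' hy' n n'
      exact disp_of_split hT hvw (av_anti hT hvw.ne (hns y hy n))
        (av_anti hT hvw.ne (hns y' hy' n')) k3 k4
    · intro y hy n hD
      rcases (disp_iff hT).1 hD v with j | j
      · exact k5 j
      · exact hns y hy n (k3.trans j)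
  · rintro q (rfl | hq) x y hxy hd
    · rcases qd_unique hT hxy hvw hd h2 with rfl | rfl
      · exact Or.inr hvU
      · exact Or.inl rfl
    · exact Or.inr (hI.mem q hq x y hxy hd)
  · rw [hY]
    rintro x (rfl | hx) y hy hn s hs t ht hxs hxt
    · have hyv : y ≠ v := by rintro rfl; exact hn hEwv
      have hd : ∀ s ∈ YY S, Av G x y (l s) → s = d := by
        intro s hs hxs
        by_contra hsd
        have := av_anti hT hvw.ne (hns s hs hsd)
        exact hyv (av_nbr_eq hT hy hvw.symm (hxs.trans this.symm))
      rcases hs with rfl | hs <;> rcases ht with rfl | ht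
      · rfl
      · have := hd t ht hxt
        subst this
        exact absurd (hxt.symm.trans hxs) k6
      · have := hd s hs hxs
        subst this
        exact absurd (hxs.symm.trans hxt) k6
      · rw [hd s hs hxs, hd t ht hxt]
    · have hz : ¬ Av G x y (l z) := by
        intro hz
        by_cases hxv : x = v
        · subst hxv
          have : y = w := av_nbr_eq hT hy hvw (hz.trans k4.symm)
          subst this
          exact hn hEvw
        · have o1 := hI.out x hx y hy (hE' _ _ hn) v hvU
          have o2 : Av G v x (l z) := av_anti hT hxv fun j => o1 (hz.trans j.symm)
          exact hout x hx (k4.trans o2.symm)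
      rcases hs with rfl | hs
      · exact absurd hxs hz
      rcases ht with rfl | ht
      · exact absurd hxt hz
      exact hI.one x hx y hy (hE' _ _ hn) s hs t ht hxs hxt
  · rintro x (rfl | hx) y hy hn t (rfl | ht) hxt
    · exact hxt.right rfl
    · have hyv : y ≠ v := by rintro rfl; exact hn hEwv
      have : Av G v x t := by
        apply av_anti hT hvw.ne.symm
        intro j
        exact hyv (av_nbr_eq hT hy hvw.symm (hxt.trans j.symm))
      exact hout t ht this
    · by_cases hxv : x = v
      · subst hxv
        have : y = t := av_nbr_eq hT hy hvw hxt
        subst this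
        exact hn hEvw
      · have o1 := hI.out x hx y hy (hE' _ _ hn) v hvU
        exact o1 (hxt.trans (Av.adj hvw.symm hxt.right (Ne.symm hxv)))
    · exact hI.out x hx y hy (hE' _ _ hn) t ht hxt

theorem crossing {α : Type*} {r : α → α → Prop} {S : Set α} {a b : α}
    (h : Relation.ReflTransGen r a b) (ha : a ∈ S) (hb : b ∉ S) :
    ∃ x y, r x y ∧ x ∈ S ∧ y ∉ S := by
  induction h with
  | refl => exact absurd ha hb
  | @tail x y _ hxy ih =>
    by_cases hx : x ∈ S
    · exact ⟨x, y, hxy, hx, hb⟩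
    · exact ih hx

end main

/-- If `L` is a linked system of `n - 3` quartets of a binary phylogenetic tree
`T` on `n` leaves — each quartet of `L` distinguishes a distinct internal edge
of `T` and the associated graph `G_T(L)` is connected — then `T` is the unique
binary phylogenetic tree displaying every quartet in `L`: any binary
phylogenetic tree on the same taxa displaying all of `L` is isomorphic to `T`
by a leaf-label preserving isomorphism. -/
theorem stmt10 {V X : Type*} [Fintype V] [Fintype X]
    (G : SimpleGraph V) (ℓ : X → V) (n : ℕ) (hn : 4 ≤ n) (hX : Nat.card X = n)
    (hT : IsBinaryTree G) (hinj : Function.Injective ℓ)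
    (hrange : Set.range ℓ = {v | IsLeaf G v})
    (L : Set (Sym2 (Sym2 X)))
    (hcard : L.ncard = n - 3)
    (hdisp : ∀ q ∈ L, DisplaysQ G ℓ q)
    (hedge : ∀ q ∈ L, ∃ v1 v2, G.Adj v1 v2 ∧ IsDeg3 G v1 ∧ IsDeg3 G v2 ∧
      QDist G ℓ q v1 v2)
    (hdistinct : ∀ q ∈ L, ∀ q' ∈ L, ∀ v1 v2, QDist G ℓ q v1 v2 →
      (QDist G ℓ q' v1 v2 ∨ QDist G ℓ q' v2 v1) → q = q')
    (hconn : ∀ q ∈ L, ∀ q' ∈ L,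
      Relation.ReflTransGen (fun a b => a ∈ L ∧ b ∈ L ∧ LinkedQ G ℓ a b) q q')
    {W : Type*} [Fintype W] (H : SimpleGraph W) (m : X → W)
    (hH : IsBinaryTree H) (hm : Function.Injective m)
    (hmrange : Set.range m = {w | IsLeaf H w})
    (hHdisp : ∀ q ∈ L, DisplaysQ H m q) :
    ∃ φ : G ≃g H, ∀ x, φ (ℓ x) = m x := by
  have h : LTr G ℓ := ⟨hT, hinj, hrange⟩
  have h' : LTr H m := ⟨hH, hm, hmrange⟩
  have hLfin : L.Finite := Set.toFinite _
  have hne : L.Nonempty := by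
    rw [← Set.ncard_pos hLfin]; omega
  have main : ∀ k, 1 ≤ k → k ≤ L.ncard →
      ∃ S ⊆ L, S.ncard = k ∧ S.Nonempty ∧ ∃ U, InvT G ℓ H m S U := by
    intro k hk
    induction k, hk using Nat.le_induction with
    | base =>
      intro _
      obtain ⟨q, hq⟩ := hne
      obtain ⟨v1, v2, hadj, -, -, hd⟩ := hedge q hq
      exact ⟨{q}, by simpa using hq, by simp, ⟨q, rfl⟩, _,
        InvT.base h h' (hdisp q hq) (hHdisp q hq) hadj hd⟩
    | succ k hk ih =>
      intro hkL
      obtain ⟨S, hSL, hSk, ⟨q0, hq0⟩, U, hI⟩ := ih (by omega)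
      have : ∃ q ∈ L, q ∉ S := by
        by_contra hcon
        push Not at hcon
        have : S = L := Set.Subset.antisymm hSL hcon
        rw [this] at hSk
        omega
      obtain ⟨q, hqL, hqS⟩ := this
      obtain ⟨q1, q2, ⟨h1L, h2L, u, v, w, huw, huv, hvw, h1, h2, h5⟩, h1S, h2S⟩ :=
        crossing (hconn q0 (hSL hq0) q hqL) hq0 hqS
      have hnE : ¬ EE G ℓ S v w := by
        rintro ⟨q3, h3S, h3⟩
        apply h2S
        have : q3 = q2 := by
          rcases h3 with h3 | h3
          · exact hdistinct q3 (hSL h3S) q2 h2L v w h3 h2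
          · exact hdistinct q3 (hSL h3S) q2 h2L w v h3 h2.symm
        exact this ▸ h3S
      refine ⟨insert q2 S, Set.insert_subset h2L hSL, ?_, ⟨q2, Or.inl rfl⟩, insert w U,
        hI.extend h h' h1S h2S (hdisp q1 h1L) (hdisp q2 h2L) (hHdisp q2 h2L)
          huw huv hvw h1 h2 h5 hnE⟩
      rw [Set.ncard_insert_of_notMem h2S (Set.toFinite _), hSk]
  obtain ⟨S, hSL, hSk, -, U, hI⟩ := main L.ncard (by omega) le_rfl
  have hYuniv : YY S = Set.univ := by
    apply Set.eq_of_subset_of_ncard_le (Set.subset_univ _) _ (Set.toFinite _)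
    rw [hI.card, hSk, hcard, Set.ncard_univ, hX]
    omega
  have imp : ∀ p q r s, DD G ℓ p q r s → DD H m p q r s := by
    intro p q r s
    exact hI.imp p (hYuniv ▸ trivial) q (hYuniv ▸ trivial) r (hYuniv ▸ trivial)
      s (hYuniv ▸ trivial)
  have hX' : Nonempty X := by
    apply (Nat.card_pos_iff.1 _).1
    omega
  refine recon h h' hX' ?_
  funext a b c d
  apply propext
  refine ⟨imp a b c d, fun k => ?_⟩
  have nac : a ≠ c := by rintro rfl; exact disp_ne hH.1 k rfl
  have nad : a ≠ d := by rintro rfl; exact disp_ne hH.1 (disp_sr k) rfl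
  have nbc : b ≠ c := by rintro rfl; exact disp_ne hH.1 (disp_sl k) rfl
  have nbd : b ≠ d := by rintro rfl; exact disp_ne hH.1 (disp_sl (disp_sr k)) rfl
  by_cases hab : a = b
  · subst hab
    exact disp_self hT.1 (h.leaf _) (fun e => nac (hinj e.symm)) (fun e => nad (hinj e.symm))
  by_cases hcd : c = d
  · subst hcd
    exact disp_comm (disp_self hT.1 (h.leaf _) (fun e => nac (hinj e)) (fun e => nbc (hinj e)))
  rcases h.total hab nac nad nbc nbd hcd with j | j | j
  · exact j
  · exact absurd (imp _ _ _ _ j) (disp_excl hH.1 k)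
  · exact absurd (disp_sr (disp_sr (imp _ _ _ _ j))) (disp_excl hH.1 (disp_sr k))
end

section
/- Any efficient quartet system E(T) of an unrooted binary phylogenetic tree T on n ≥ 4 leaves is definitive: T is the unique binary phylogenetic tree on the leaf set of T that displays every quartet in E(T). -/
open SimpleGraph

variable {V : Type*}

variable {X : Type*}

namespace QP

def C (G : SimpleGraph V) (y x z : V) : Prop := Avoids G {y} x z

section basic
variable {G : SimpleGraph V}

theorem C.symm {y x z : V} (h : C G y x z) : C G y z x := by
  obtain ⟨w, hw⟩ := h
  exact ⟨w.reverse, by simpa using hw⟩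

theorem C.trans {y x z t : V} (h : C G y x z) (h' : C G y z t) : C G y x t := by
  obtain ⟨w, hw⟩ := h
  obtain ⟨w', hw'⟩ := h'
  refine ⟨w.append w', fun u hu => ?_⟩
  rw [Walk.mem_support_append_iff] at hu
  exact hu.elim (hw u) (hw' u)

theorem C.ne {y x z : V} (h : C G y x z) : x ≠ y := by
  obtain ⟨w, hw⟩ := h
  exact hw x w.start_mem_support

theorem C.ne' {y x z : V} (h : C G y x z) : z ≠ y := h.symm.ne

theorem C.rfl' {y x : V} (h : x ≠ y) : C G y x x :=
  ⟨Walk.nil, by simpa using h⟩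

theorem C.adj {w u v : V} (h : G.Adj u v) (h1 : u ≠ w) (h2 : v ≠ w) : C G w u v :=
  ⟨h.toWalk, by simp [h1, h2]⟩

theorem exists_path (hG : G.IsTree) (u v : V) : ∃ p : G.Walk u v, p.IsPath := by
  classical
  obtain ⟨p⟩ := hG.1.preconnected u v
  exact ⟨p.toPath.1, p.toPath.2⟩

theorem C.path {y x z : V} (h : C G y x z) : ∃ p : G.Walk x z, p.IsPath ∧ y ∉ p.support := by
  classical
  obtain ⟨w, hw⟩ := h
  refine ⟨w.toPath.1, w.toPath.2, fun hy => hw y (Walk.support_toPath_subset w hy) rfl⟩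

theorem C.tot (hG : G.IsTree) {w u : V} (x : V) (h : w ≠ u) : C G w x u ∨ C G u x w := by
  classical
  obtain ⟨p, hp⟩ := exists_path hG x u
  by_cases hw : w ∈ p.support
  · right
    refine ⟨p.takeUntil w hw, fun z hz hzu => ?_⟩
    obtain rfl : z = u := hzu
    exact Walk.endpoint_notMem_support_takeUntil hp hw h.symm hz
  · left
    exact ⟨p, fun z hz hzu => hw (by obtain rfl : z = w := hzu; exact hz)⟩

theorem C.nbr (hG : G.IsTree) {u z : V} (h : z ≠ u) : ∃ t, G.Adj u t ∧ C G u z t := by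
  obtain ⟨p, hp⟩ := exists_path hG u z
  cases p with
  | nil => exact absurd rfl h
  | cons ha q =>
    rename_i t
    rw [Walk.cons_isPath_iff] at hp
    exact ⟨t, ha, C.symm ⟨q, fun a h1 h2 => hp.2 (by obtain rfl : a = u := h2; exact h1)⟩⟩

theorem C.excl (hG : G.IsTree) {u w v : V} (ha : G.Adj u w) (h1 : C G w v u) (h2 : C G u v w) :
    False := by
  obtain ⟨p, hp, hpw⟩ := h1.path
  obtain ⟨q, hq, hqu⟩ := h2.path
  have hq' : (q.concat ha.symm).IsPath := hq.concat hqu ha.symm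
  have := hG.2.path_unique ⟨p, hp⟩ ⟨_, hq'⟩
  have h3 : p = q.concat ha.symm := congrArg Subtype.val this
  apply hpw
  rw [h3, Walk.support_concat]
  simp

theorem C.nbr_eq (hG : G.IsTree) {u a b : V} (ha : G.Adj u a) (hb : G.Adj u b)
    (h : C G u a b) : a = b := by
  by_contra hne
  exact C.excl hG hb (C.adj ha.symm hne hb.ne) h

theorem C.leaf (hG : G.IsTree) {u a b : V} (hu : IsLeaf G u) (ha : a ≠ u) (hb : b ≠ u) :
    C G u a b := by
  obtain ⟨t, ht, h1⟩ := C.nbr hG ha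
  obtain ⟨s, hs, h2⟩ := C.nbr hG hb
  obtain rfl := hu.unique ht hs
  exact h1.trans h2.symm

theorem adj_iff (hG : G.IsTree) {u v : V} :
    G.Adj u v ↔ u ≠ v ∧ ∀ w, w ≠ u → w ≠ v → C G w u v := by
  constructor
  · intro h
    exact ⟨h.ne, fun w h1 h2 => C.adj h h1.symm h2.symm⟩
  · rintro ⟨hne, h⟩
    obtain ⟨t, ht, h1⟩ := C.nbr hG hne.symm
    by_cases htv : t = v
    · exact htv ▸ ht
    · exact (C.excl hG ht (h t ht.ne' htv).symm h1).elim

theorem leaf_not_deg3 {u : V} (h : IsLeaf G u) (h' : IsDeg3 G u) : False := by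
  obtain ⟨a, b, c, hab, -, -, ha, hb, -⟩ := h'
  exact hab (h.unique ha hb)

/-- the two neighbours of a degree three vertex pointing away from `j` -/
theorem deg3_split (hG : G.IsTree) {i j : V} (hi : IsDeg3 G i) (hij : j ≠ i) :
    ∃ s t, G.Adj i s ∧ G.Adj i t ∧ ¬ C G i s t ∧ ¬ C G i s j ∧ ¬ C G i t j ∧
      ∀ z, z ≠ i → C G i z j ∨ C G i z s ∨ C G i z t := by
  obtain ⟨a, b, c, hab, hac, hbc, ha, hb, hc, hall⟩ := hi
  have key : ∀ r s t, r ≠ s → r ≠ t → s ≠ t → G.Adj i r → G.Adj i s → G.Adj i t →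
      (∀ u, G.Adj i u → u = r ∨ u = s ∨ u = t) → C G i j r → ∃ s t, G.Adj i s ∧ G.Adj i t ∧ ¬ C G i s t ∧ ¬ C G i s j ∧ ¬ C G i t j ∧
      ∀ z, z ≠ i → C G i z j ∨ C G i z s ∨ C G i z t := by
    intro r s t hrs hrt hst hr hs ht hu hj
    refine ⟨s, t, hs, ht, fun h => hst (C.nbr_eq hG hs ht h),
      fun h => hrs (C.nbr_eq hG hs hr (h.trans hj)).symm,
      fun h => hrt (C.nbr_eq hG ht hr (h.trans hj)).symm, fun z hz => ?_⟩
    obtain ⟨k, hk, h1⟩ := C.nbr hG hz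
    rcases hu k hk with rfl | rfl | rfl
    · exact Or.inl (h1.trans hj.symm)
    · exact Or.inr (Or.inl h1)
    · exact Or.inr (Or.inr h1)
  obtain ⟨k, hk, h1⟩ := C.nbr hG hij
  rcases hall k hk with rfl | rfl | rfl
  · exact key _ b c hab hac hbc ha hb hc hall h1
  · exact key _ a c hab.symm hbc hac hb ha hc (by grind) h1
  · exact key _ a b hac.symm hbc.symm hab hc ha hb (by grind) h1

theorem step_sub (hG : G.IsTree) {i j t : V} (ht : G.Adj i t) (h : ¬ C G i t j) :
    {z | ¬ C G t z i} ⊂ {z | ¬ C G i z j} := by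
  rw [Set.ssubset_iff_of_subset]
  · exact ⟨i, fun h => h.ne rfl, fun h' => h' (C.rfl' ht.ne)⟩
  · intro z hz hzj
    have := (C.tot hG z ht.ne').resolve_left hz
    exact h (this.symm.trans hzj)

theorem exists_leaf [Finite V] (hT : IsBinaryTree G) : ∀ (k : ℕ) (u v : V), v ≠ u →
    {z | ¬ C G u z v}.ncard ≤ k → ∃ x, IsLeaf G x ∧ ¬ C G u x v := by
  intro k
  induction k with
  | zero =>
    intro u v huv hk
    exfalso
    have : {z | ¬ C G u z v} = ∅ := by
      rw [← Set.ncard_eq_zero]; omega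
    have h2 : u ∈ {z | ¬ C G u z v} := fun h => h.ne rfl
    rw [this] at h2
    exact h2
  | succ k ih =>
    intro u v huv hk
    rcases hT.2 u with hu | hu
    · exact ⟨u, hu, fun h => h.ne rfl⟩
    · obtain ⟨s, t, hs, -, -, hsj, -, -⟩ := deg3_split hT.1 hu huv
      have := Set.ncard_lt_ncard (step_sub hT.1 hs hsj)
      obtain ⟨x, hx, hxs⟩ := ih s u hs.ne (by omega)
      refine ⟨x, hx, fun h => ?_⟩
      have := (C.tot hT.1 x hs.ne').resolve_left hxs
      exact hsj (this.symm.trans h)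

theorem exists_leaf_nbr [Finite V] (hT : IsBinaryTree G) {u t : V} (ht : G.Adj u t) :
    ∃ x, IsLeaf G x ∧ C G u x t := by
  obtain ⟨x, hx, h⟩ := exists_leaf hT _ t u ht.ne le_rfl
  exact ⟨x, hx, (C.tot hT.1 x ht.ne').resolve_left h⟩

theorem exists_leaf2 [Finite V] (hT : IsBinaryTree G) {u w : V} (h : w ≠ u) (z : V) :
    ∃ x, IsLeaf G x ∧ ¬ C G u x w ∧ ¬ C G u x z := by
  rcases hT.2 u with hu | hu
  · exact ⟨u, hu, fun h => h.ne rfl, fun h => h.ne rfl⟩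
  · obtain ⟨s, t, hs, ht, hst, hsj, htj, -⟩ := deg3_split hT.1 hu h
    obtain ⟨x, hx, hxs⟩ := exists_leaf_nbr hT hs
    obtain ⟨y, hy, hyt⟩ := exists_leaf_nbr hT ht
    by_cases hz : C G u x z
    · exact ⟨y, hy, fun h => htj (hyt.symm.trans h),
        fun h => hst (hxs.symm.trans (hz.trans (h.symm.trans hyt)))⟩
    · exact ⟨x, hx, fun h => hsj (hxs.symm.trans h), hz⟩

theorem exists_median [Finite V] (hG : G.IsTree) (a b c : V) :
    ∃ y, ¬ C G y a b ∧ ¬ C G y a c ∧ ¬ C G y b c := by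
  have hne : {y | ¬ C G y a b}.Nonempty := ⟨a, fun h => h.ne rfl⟩
  obtain ⟨y, hy, hmin⟩ := Set.exists_min_image {y | ¬ C G y a b}
    (fun y => {z | C G y z c}.ncard) (Set.toFinite _) hne
  by_cases hyc : y = c
  · subst hyc
    exact ⟨y, hy, fun h => h.ne' rfl, fun h => h.ne' rfl⟩
  obtain ⟨t, ht, htc⟩ := C.nbr hG (Ne.symm hyc)
  have hlt : {z | C G t z c} ⊂ {z | C G y z c} := by
    rw [Set.ssubset_iff_of_subset]
    · exact ⟨t, htc.symm, fun h => h.ne rfl⟩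
    · intro z hz
      have h1 : ¬ C G t c y := fun h => C.excl hG ht h htc
      have h2 : ¬ C G t z y := fun h => h1 (C.trans (C.symm hz) h)
      exact ((C.tot hG z ht.ne').resolve_left h2).trans htc.symm
  have hlt := Set.ncard_lt_ncard hlt
  have hab : C G t a b := by
    by_contra h
    have := hmin t h
    omega
  have key : ∀ a b, ¬ C G y a b → C G t a b → ¬ C G y a c := by
    intro a b hy hab hac
    have h1 : C G y a t := hac.trans htc
    have h2 : ¬ C G t a y := fun h => C.excl hG ht h h1
    have h3 : ¬ C G t b y := fun h => h2 (hab.trans h)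
    have h4 := (C.tot hG b ht.ne').resolve_left h3
    exact hy (h1.trans h4.symm)
  exact ⟨y, hy, key a b hy hab, key b a (fun h => hy h.symm) hab.symm⟩

theorem dist_aux (hG : G.IsTree) {i j a b : V} (hij : i ≠ j) (p : G.Walk i j) (hp : p.IsPath)
    (h : AvoidsE G {e | e ∈ p.edges} a b) (hi : ¬ Avoids G {i} a b) : ¬ C G i a j := by
  classical
  intro haj
  obtain ⟨w, hw⟩ := h
  have hiw : i ∈ w.support := by
    by_contra hc
    exact hi ⟨w, fun u hu hu' => hc (by obtain rfl : u = i := hu'; exact hu)⟩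
  let w1 := (w.takeUntil i hiw).reverse
  have hsub : ∀ e ∈ w1.toPath.1.edges, e ∈ w.edges := by
    intro e he
    have := Walk.edges_toPath_subset w1 he
    simp only [w1, Walk.edges_reverse, List.mem_reverse] at this
    exact Walk.edges_takeUntil_subset w hiw this
  obtain ⟨q, hq, hsub⟩ : ∃ q : G.Walk i a, q.IsPath ∧ ∀ e ∈ q.edges, e ∈ w.edges :=
    ⟨_, w1.toPath.2, hsub⟩
  cases q with
  | nil => exact haj.ne rfl
  | cons h1 q =>
    cases p with
    | nil => exact hij rfl
    | cons h2 p =>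
      rename_i t s
      rw [Walk.cons_isPath_iff] at hp hq
      have c1 : C G i t a := ⟨q, fun u h3 h4 => hq.2 (by obtain rfl : u = i := h4; exact h3)⟩
      have c2 : C G i s j := ⟨p, fun u h3 h4 => hp.2 (by obtain rfl : u = i := h4; exact h3)⟩
      obtain rfl := C.nbr_eq hG h1 h2 (c1.trans (haj.trans c2.symm))
      refine hw s(i, t) (hsub _ (by simp)) (by simp)

theorem distPath_spec (hG : G.IsTree) {i j a b c d : V} (hij : i ≠ j)
    (h : DistPath G a b c d i j) :
    ¬ C G i a b ∧ ¬ C G j c d ∧ ¬ C G i a j ∧ ¬ C G i b j ∧ ¬ C G j c i ∧ ¬ C G j d i := by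
  have rev : ∀ (F : Set (Sym2 V)) a b, AvoidsE G F a b → AvoidsE G F b a := by
    rintro F a b ⟨w, hw⟩
    exact ⟨w.reverse, by simpa using hw⟩
  obtain ⟨p, hp, h1, h2, -, h3, h4⟩ := h
  have e : {e | e ∈ p.edges} = {e | e ∈ p.reverse.edges} := by simp
  have h2' := h2
  rw [e] at h2'
  exact ⟨h3, h4, dist_aux hG hij p hp h1 h3,
    dist_aux hG hij p hp (rev _ _ _ h1) (fun h => h3 (C.symm h)),
    dist_aux hG hij.symm p.reverse hp.reverse h2' h4,
    dist_aux hG hij.symm p.reverse hp.reverse (rev _ _ _ h2') (fun h => h4 (C.symm h))⟩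

theorem displays_spec {a b c d : V} (h : Displays G a b c d) (y : V) :
    C G y a b ∨ C G y c d := by
  obtain ⟨p, q, hpq⟩ := h
  by_cases hy : y ∈ p.support
  · exact Or.inr ⟨q, fun u h3 h4 => hpq y hy (by obtain rfl : u = y := h4; exact h3)⟩
  · exact Or.inl ⟨p, fun u h3 h4 => hy (by obtain rfl : u = y := h4; exact h3)⟩

theorem displaysQ_spec {ℓ : X → V} {a b c d : X} (h : DisplaysQ G ℓ s(s(a, b), s(c, d))) (y : V) :
    C G y (ℓ a) (ℓ b) ∨ C G y (ℓ c) (ℓ d) := by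
  obtain ⟨a', b', c', d', -, -, -, -, -, -, he, hd⟩ := h
  have := displays_spec hd y
  simp only [Sym2.eq_iff] at he
  have hs : ∀ x z, C G y x z → C G y z x := fun _ _ h => h.symm
  rcases he with ⟨⟨rfl, rfl⟩ | ⟨rfl, rfl⟩, ⟨rfl, rfl⟩ | ⟨rfl, rfl⟩⟩ |
    ⟨⟨rfl, rfl⟩ | ⟨rfl, rfl⟩, ⟨rfl, rfl⟩ | ⟨rfl, rfl⟩⟩ <;> grind

theorem card_tree [Fintype V] [Fintype X] (hT : IsBinaryTree G) (ℓ : X → V)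
    (hinj : Function.Injective ℓ) (hrange : Set.range ℓ = {v | IsLeaf G v}) :
    Fintype.card V + 2 = 2 * Fintype.card X := by
  classical
  have h1 := hT.1.card_edgeFinset
  have h2 := G.sum_degrees_eq_twice_card_edges
  have hd : ∀ v, G.degree v + (if IsLeaf G v then 2 else 0) = 3 := by
    intro v
    split_ifs with hv
    · obtain ⟨u, hu, hu'⟩ := hv
      have : G.neighborFinset v = {u} := by
        ext z; simp only [mem_neighborFinset, Finset.mem_singleton]
        exact ⟨hu' z, fun h => h ▸ hu⟩
      rw [← card_neighborFinset_eq_degree, this]; simp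
    · obtain ⟨a, b, c, hab, hac, hbc, ha, hb, hc, h⟩ := (hT.2 v).resolve_left hv
      have : G.neighborFinset v = {a, b, c} := by
        ext z; simp only [mem_neighborFinset, Finset.mem_singleton, Finset.mem_insert]
        exact ⟨h z, by rintro (rfl | rfl | rfl) <;> assumption⟩
      rw [← card_neighborFinset_eq_degree, this, Finset.card_eq_three.2 ⟨a, b, c, hab, hac, hbc, rfl⟩]
  have h3 : ∑ v, (G.degree v + (if IsLeaf G v then 2 else 0)) = ∑ v : V, 3 :=
    Finset.sum_congr rfl (fun v _ => hd v)
  have h4 : (Finset.univ.filter (fun v => IsLeaf G v)).card = Fintype.card X := by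
    rw [← Finset.card_univ, ← Finset.card_image_of_injective _ hinj]
    congr 1
    ext v
    have : v ∈ Set.range ℓ ↔ v ∈ {v | IsLeaf G v} := by rw [hrange]
    simp only [Set.mem_range, Set.mem_setOf_eq] at this
    simp [this]
  rw [Finset.sum_add_distrib, ← Finset.sum_filter, Finset.sum_const, h2, h4] at h3
  simp at h3
  omega

end basic

section labelled
variable {G : SimpleGraph V} {W : Type*} {H : SimpleGraph W} {ℓ : X → V} {m : X → W}

/-- vertices `v` and `y` induce the same partition of the taxa -/
def Same (G : SimpleGraph V) (ℓ : X → V) (H : SimpleGraph W) (m : X → W) (v : V) (y : W) : Prop :=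
  ∀ x x', C G v (ℓ x) (ℓ x') ↔ C H y (m x) (m x')

theorem leaf_lab (hrange : Set.range ℓ = {v | IsLeaf G v}) {v : V} (h : IsLeaf G v) :
    ∃ x, ℓ x = v := by
  have : v ∈ Set.range ℓ := by rw [hrange]; exact h
  exact this

theorem lab_leaf (hrange : Set.range ℓ = {v | IsLeaf G v}) (x : X) : IsLeaf G (ℓ x) := by
  have : ℓ x ∈ {v | IsLeaf G v} := by rw [← hrange]; exact ⟨x, rfl⟩
  exact this

theorem same_inj [Finite V] (hT : IsBinaryTree G) (hrange : Set.range ℓ = {v | IsLeaf G v})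
    {u w : V} (h : ∀ x x', C G u (ℓ x) (ℓ x') ↔ C G w (ℓ x) (ℓ x')) : u = w := by
  by_contra hne
  obtain ⟨x, hx, hxw, -⟩ := exists_leaf2 hT (Ne.symm hne) w
  obtain ⟨z, hz, hzw, hzx⟩ := exists_leaf2 hT (Ne.symm hne) x
  obtain ⟨x, rfl⟩ := leaf_lab hrange hx
  obtain ⟨z, rfl⟩ := leaf_lab hrange hz
  have h1 := (C.tot hT.1 (ℓ x) hne).resolve_left hxw
  have h2 := (C.tot hT.1 (ℓ z) hne).resolve_left hzw
  exact hzx ((h z x).2 (h2.trans h1.symm))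

theorem C_lab_iff [Finite V] (hT : IsBinaryTree G) (hrange : Set.range ℓ = {v | IsLeaf G v})
    {u w : V} (hne : u ≠ w) (x : X) :
    C G w (ℓ x) u ↔ ∃ x', ¬ C G u (ℓ x') (ℓ x) ∧ C G w (ℓ x') (ℓ x) := by
  constructor
  · intro h
    obtain ⟨z, hz, hzw, hzx⟩ := exists_leaf2 hT hne.symm (ℓ x)
    obtain ⟨z, rfl⟩ := leaf_lab hrange hz
    exact ⟨z, hzx, ((C.tot hT.1 (ℓ z) hne).resolve_left hzw).trans h.symm⟩
  · rintro ⟨z, h1, h2⟩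
    by_contra h
    have h3 : ¬ C G w (ℓ z) u := fun h' => h (h2.symm.trans h')
    have h4 := (C.tot hT.1 _ hne.symm).resolve_left h
    have h5 := (C.tot hT.1 _ hne.symm).resolve_left h3
    exact h1 (h5.trans h4.symm)

theorem C_iff [Finite V] (hT : IsBinaryTree G) (hrange : Set.range ℓ = {v | IsLeaf G v})
    {u v w : V} (hne : u ≠ w) :
    C G w u v ↔ ∃ x, C G w (ℓ x) u ∧ C G w (ℓ x) v := by
  constructor
  · intro h
    obtain ⟨z, hz, hzw, -⟩ := exists_leaf2 hT hne.symm w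
    obtain ⟨z, rfl⟩ := leaf_lab hrange hz
    have := (C.tot hT.1 (ℓ z) hne).resolve_left hzw
    exact ⟨z, this, this.trans h⟩
  · rintro ⟨x, h1, h2⟩
    exact h1.symm.trans h2

theorem same_leaf (hG : G.IsTree) (hH : H.IsTree) (hinj : Function.Injective ℓ)
    (hm : Function.Injective m)
    (hrange : Set.range ℓ = {v | IsLeaf G v})
    (hmrange : Set.range m = {v | IsLeaf H v}) (x : X) : Same G ℓ H m (ℓ x) (m x) := by
  intro a b
  constructor
  · intro h
    exact C.leaf hH (lab_leaf hmrange x) (fun e => h.ne (by rw [hm e]))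
      (fun e => h.ne' (by rw [hm e]))
  · intro h
    exact C.leaf hG (lab_leaf hrange x) (fun e => h.ne (by rw [hinj e]))
      (fun e => h.ne' (by rw [hinj e]))

/-- at `y`, one of the two sides is connected -/
def P (G : SimpleGraph V) (ℓ : X → V) (H : SimpleGraph W) (m : X → W) (i j : V) : Prop :=
  ∀ y, (∀ x x', ¬ C G i (ℓ x) j → ¬ C G i (ℓ x') j → C H y (m x) (m x')) ∨
    (∀ x x', ¬ C G j (ℓ x) i → ¬ C G j (ℓ x') i → C H y (m x) (m x'))

theorem P.symm {i j : V} (h : P G ℓ H m i j) : P G ℓ H m j i := fun y => (h y).symm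

theorem P_leaf (hG : G.IsTree) (hH : H.IsTree)
    (hm : Function.Injective m) (hinj : Function.Injective ℓ)
    (hrange : Set.range ℓ = {v | IsLeaf G v})
    (hmrange : Set.range m = {v | IsLeaf H v}) {i j : V} (hij : i ≠ j) (hi : IsLeaf G i) :
    P G ℓ H m i j := by
  obtain ⟨k, rfl⟩ := leaf_lab hrange hi
  intro y
  have hk : ∀ x, ¬ C G (ℓ k) (ℓ x) j → x = k := by
    intro x hx
    by_contra hne
    exact hx (C.leaf hG hi (fun e => hne (hinj e)) hij.symm)
  by_cases hy : m k = y
  · right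
    subst hy
    intro x x' hx hx'
    apply C.leaf hH (lab_leaf hmrange k)
    · intro e
      exact hx (by rw [hm e]; exact C.rfl' hij)
    · intro e
      exact hx' (by rw [hm e]; exact C.rfl' hij)
  · left
    intro x x' hx hx'
    rw [hk x hx, hk x' hx']
    exact C.rfl' hy

theorem step_facts (hG : G.IsTree) {i j t : V} (ht : G.Adj i t) (hij : j ≠ i) (h : ¬ C G i t j) :
    t ≠ j ∧ (∀ z, C G t z j ↔ C G t z i) ∧ (∀ z, C G j z t ↔ C G j z i) := by
  have h1 : t ≠ j := by
    rintro rfl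
    exact h (C.rfl' hij)
  have h2 : C G t j i := (C.tot hG j ht.ne').resolve_right (fun h' => h h'.symm)
  have h3 : C G j i t := C.adj ht hij.symm h1
  exact ⟨h1, fun z => ⟨fun h => h.trans h2, fun h => h.trans h2.symm⟩,
    fun z => ⟨fun h => h.trans h3.symm, fun h => h.trans h3⟩⟩

theorem P_all [Finite V] (hT : IsBinaryTree G) (hH : H.IsTree)
    (hm : Function.Injective m) (hinj : Function.Injective ℓ)
    (hrange : Set.range ℓ = {v | IsLeaf G v})
    (hmrange : Set.range m = {v | IsLeaf H v})
    (hq : ∀ i j, IsDeg3 G i → IsDeg3 G j → i ≠ j → ∃ a b c d : X,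
      DistPath G (ℓ a) (ℓ b) (ℓ c) (ℓ d) i j ∧ DisplaysQ H m s(s(a, b), s(c, d))) :
    ∀ (k : ℕ) (i j : V), i ≠ j →
      {z | ¬ C G i z j}.ncard + {z | ¬ C G j z i}.ncard < k → P G ℓ H m i j := by
  intro k
  induction k with
  | zero => intro i j _ h; omega
  | succ k ih =>
    intro i j hij hk
    rcases hT.2 i with hi | hi
    · exact P_leaf hT.1 hH hm hinj hrange hmrange hij hi
    rcases hT.2 j with hj | hj
    · exact (P_leaf hT.1 hH hm hinj hrange hmrange hij.symm hj).symm
    have ihl : ∀ t, G.Adj i t → ¬ C G i t j → P G ℓ H m t j := by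
      intro t ht h
      obtain ⟨h1, h2, h3⟩ := step_facts hT.1 ht hij.symm h
      apply ih t j h1
      have := Set.ncard_lt_ncard (step_sub hT.1 ht h)
      simp only [h2, h3]
      omega
    have ihr : ∀ t, G.Adj j t → ¬ C G j t i → P G ℓ H m i t := by
      intro t ht h
      obtain ⟨h1, h2, h3⟩ := step_facts hT.1 ht hij h
      apply ih i t h1.symm
      have := Set.ncard_lt_ncard (step_sub hT.1 ht h)
      simp only [h2, h3]
      omega
    intro y
    by_contra hcon
    rw [not_or] at hcon
    obtain ⟨hA, hB⟩ := hcon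
    -- branches are connected
    have brl : ∀ t, G.Adj i t → ¬ C G i t j → ∀ x x', C G i (ℓ x) t → C G i (ℓ x') t →
        C H y (m x) (m x') := by
      intro t ht h x x' hx hx'
      obtain ⟨h1, h2, h3⟩ := step_facts hT.1 ht hij.symm h
      rcases ihl t ht h y with h4 | h4
      · apply h4
        · rw [h2]; exact fun h => C.excl hT.1 ht h hx
        · rw [h2]; exact fun h => C.excl hT.1 ht h hx'
      · simp only [h3] at h4
        exact absurd h4 hB
    have brr : ∀ t, G.Adj j t → ¬ C G j t i → ∀ x x', C G j (ℓ x) t → C G j (ℓ x') t →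
        C H y (m x) (m x') := by
      intro t ht h x x' hx hx'
      obtain ⟨h1, h2, h3⟩ := step_facts hT.1 ht hij h
      rcases ihr t ht h y with h4 | h4
      · simp only [h3] at h4
        exact absurd h4 hA
      · apply h4
        · rw [h2]; exact fun h => C.excl hT.1 ht h hx
        · rw [h2]; exact fun h => C.excl hT.1 ht h hx'
    have fin : ∀ (i j : V), i ≠ j → IsDeg3 G i → (∀ t, G.Adj i t → ¬ C G i t j → ∀ x x',
        C G i (ℓ x) t → C G i (ℓ x') t → C H y (m x) (m x')) → ∀ a b,
        ¬ C G i (ℓ a) (ℓ b) → ¬ C G i (ℓ a) j → ¬ C G i (ℓ b) j → C H y (m a) (m b) →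
        ∀ x x', ¬ C G i (ℓ x) j → ¬ C G i (ℓ x') j → C H y (m x) (m x') := by
      intro i j hij hi br a b hab ha hb hC x x' hx hx'
      obtain ⟨s, t, hs, ht, hst, hsj, htj, hcov⟩ := deg3_split hT.1 hi hij.symm
      have hl : ∀ x, ℓ x ≠ i := fun x e => leaf_not_deg3 (lab_leaf hrange x) (e ▸ hi)
      have cov : ∀ x, ¬ C G i (ℓ x) j → C G i (ℓ x) s ∨ C G i (ℓ x) t :=
        fun x hx => (hcov _ (hl x)).resolve_left hx
      have bs := br s hs hsj
      have bt := br t ht htj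
      have near : ∀ x, ¬ C G i (ℓ x) j → C H y (m x) (m a) := by
        intro x hx
        rcases cov x hx with h1 | h1 <;> rcases cov a ha with h2 | h2 <;>
          rcases cov b hb with h3 | h3
        · exact bs _ _ h1 h2
        · exact bs _ _ h1 h2
        · exact (bs _ _ h1 h3).trans hC.symm
        · exact absurd (h2.trans h3.symm) hab
        · exact absurd (h2.trans h3.symm) hab
        · exact (bt _ _ h1 h3).trans hC.symm
        · exact bt _ _ h1 h2
        · exact bt _ _ h1 h2
      exact (near x hx).trans (near x' hx').symm
    obtain ⟨a, b, c, d, hd, hdisp⟩ := hq i j hi hj hij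
    obtain ⟨e1, e2, e3, e4, e5, e6⟩ := distPath_spec hT.1 hij hd
    rcases displaysQ_spec hdisp y with h | h
    · exact hA (fin i j hij hi brl a b e1 e3 e4 h)
    · exact hB (fin j i hij.symm hj brr c d e2 e5 e6 h)

theorem exists_same [Finite V] [Finite W] (hT : IsBinaryTree G) (hH : H.IsTree)
    (hm : Function.Injective m) (hinj : Function.Injective ℓ)
    (hrange : Set.range ℓ = {v | IsLeaf G v})
    (hmrange : Set.range m = {v | IsLeaf H v})
    (hP : ∀ i j, i ≠ j → P G ℓ H m i j) (v : V) : ∃ y, Same G ℓ H m v y := by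
  rcases hT.2 v with hv | hv
  · obtain ⟨x, rfl⟩ := leaf_lab hrange hv
    exact ⟨m x, same_leaf hT.1 hH hinj hm hrange hmrange x⟩
  have hl : ∀ x, ℓ x ≠ v := fun x e => leaf_not_deg3 (lab_leaf hrange x) (e ▸ hv)
  obtain ⟨a, b, c, hab, hac, hbc, ha, hb, hc, hall⟩ := hv
  obtain ⟨xa, hxa, ca⟩ := exists_leaf_nbr hT ha
  obtain ⟨xb, hxb, cb⟩ := exists_leaf_nbr hT hb
  obtain ⟨xc, hxc, cc⟩ := exists_leaf_nbr hT hc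
  obtain ⟨xa, rfl⟩ := leaf_lab hrange hxa
  obtain ⟨xb, rfl⟩ := leaf_lab hrange hxb
  obtain ⟨xc, rfl⟩ := leaf_lab hrange hxc
  obtain ⟨y, y1, y2, y3⟩ := exists_median hH (m xa) (m xb) (m xc)
  -- each branch is connected at `y`
  have br : ∀ t s r xs xr, G.Adj v t → G.Adj v s → G.Adj v r → t ≠ s → t ≠ r →
      C G v (ℓ xs) s → C G v (ℓ xr) r → ¬ C H y (m xs) (m xr) →
      ∀ x x', C G v (ℓ x) t → C G v (ℓ x') t → C H y (m x) (m x') := by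
    intro t s r xs xr ht hs hr hts htr h1 h2 h3 x x' hx hx'
    rcases hP t v ht.ne' y with h4 | h4
    · exact h4 _ _ (fun h => C.excl hT.1 ht h hx) (fun h => C.excl hT.1 ht h hx')
    · exact absurd (h4 xs xr (fun h => hts (C.nbr_eq hT.1 hs ht (h1.symm.trans h)).symm)
        (fun h => htr (C.nbr_eq hT.1 hr ht (h2.symm.trans h)).symm)) h3
  have bra := br a b c xb xc ha hb hc hab hac cb cc y3
  have brb := br b a c xa xc hb ha hc hab.symm hbc ca cc y2
  have brc := br c a b xa xb hc ha hb hac.symm hbc.symm ca cb y1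
  have cov : ∀ x, C G v (ℓ x) a ∨ C G v (ℓ x) b ∨ C G v (ℓ x) c := by
    intro x
    obtain ⟨t, ht, h⟩ := C.nbr hT.1 (hl x)
    rcases hall t ht with rfl | rfl | rfl
    · exact Or.inl h
    · exact Or.inr (Or.inl h)
    · exact Or.inr (Or.inr h)
  refine ⟨y, fun x x' => ⟨fun h => ?_, fun h => ?_⟩⟩
  · rcases cov x with h1 | h1 | h1
    · exact bra _ _ h1 (h.symm.trans h1)
    · exact brb _ _ h1 (h.symm.trans h1)
    · exact brc _ _ h1 (h.symm.trans h1)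
  · rcases cov x with h1 | h1 | h1 <;> rcases cov x' with h2 | h2 | h2
    · exact h1.trans h2.symm
    · exact absurd ((bra _ _ ca h1).trans (h.trans (brb _ _ h2 cb))) y1
    · exact absurd ((bra _ _ ca h1).trans (h.trans (brc _ _ h2 cc))) y2
    · exact absurd ((bra _ _ ca h2).trans (h.symm.trans (brb _ _ h1 cb))) y1
    · exact h1.trans h2.symm
    · exact absurd ((brb _ _ cb h1).trans (h.trans (brc _ _ h2 cc))) y3
    · exact absurd ((bra _ _ ca h2).trans (h.symm.trans (brc _ _ h1 cc))) y2
    · exact absurd ((brb _ _ cb h2).trans (h.symm.trans (brc _ _ h1 cc))) y3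
    · exact h1.trans h2.symm

end labelled

end QP

/-- Any efficient quartet system `E(T)` of an unrooted binary phylogenetic tree
`T` on `n ≥ 4` leaves is definitive: `T` is the unique binary phylogenetic tree
on the taxa of `T` displaying every quartet in `E(T)`. Here `efq i j` is the
efficient quartet of the pair of internal vertices `(i, j)`, a quartet of
leaves distinguishing the path between `i` and `j`, and `E(T)` is the set of
all such quartets over pairs of distinct internal vertices. -/
theorem stmt11 {V X : Type*} [Fintype V] [Fintype X]
    (G : SimpleGraph V) (ℓ : X → V) (n : ℕ) (hn : 4 ≤ n) (hX : Nat.card X = n)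
    (hT : IsBinaryTree G) (hinj : Function.Injective ℓ)
    (hrange : Set.range ℓ = {v | IsLeaf G v})
    (efq : V → V → Sym2 (Sym2 X))
    (hsym : ∀ i j, efq i j = efq j i)
    (hq : ∀ i j, IsDeg3 G i → IsDeg3 G j → i ≠ j →
      ∃ a b c d : X, efq i j = s(s(a, b), s(c, d)) ∧
        DistPath G (ℓ a) (ℓ b) (ℓ c) (ℓ d) i j)
    {W : Type*} [Fintype W] (H : SimpleGraph W) (m : X → W)
    (hH : IsBinaryTree H) (hm : Function.Injective m)
    (hmrange : Set.range m = {w | IsLeaf H w})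
    (hHdisp : ∀ q ∈ {q | ∃ i j, IsDeg3 G i ∧ IsDeg3 G j ∧ i ≠ j ∧ q = efq i j},
      DisplaysQ H m q) :
    ∃ φ : G ≃g H, ∀ x, φ (ℓ x) = m x := by
  classical
  have hP : ∀ i j, i ≠ j → QP.P G ℓ H m i j := by
    intro i j hij
    refine QP.P_all hT hH.1 hm hinj hrange hmrange ?_ _ i j hij (Nat.lt_succ_self _)
    intro i j hi hj hij
    obtain ⟨a, b, c, d, he, hd⟩ := hq i j hi hj hij
    exact ⟨a, b, c, d, hd, he ▸ hHdisp _ ⟨i, j, hi, hj, hij, rfl⟩⟩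
  choose φ hφ using QP.exists_same hT hH.1 hm hinj hrange hmrange hP
  have hφinj : Function.Injective φ := by
    intro u v huv
    apply QP.same_inj hT hrange
    intro x x'
    rw [hφ u x x', hφ v x x', huv]
  have hcard : Fintype.card V = Fintype.card W := by
    have h1 := QP.card_tree hT ℓ hinj hrange
    have h2 := QP.card_tree hH m hm hmrange
    omega
  have hbij : Function.Bijective φ := (Fintype.bijective_iff_injective_and_card φ).2 ⟨hφinj, hcard⟩
  have hC : ∀ u v w, u ≠ w → v ≠ w → (QP.C G w u v ↔ QP.C H (φ w) (φ u) (φ v)) := by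
    intro u v w huw hvw
    have huw' : φ u ≠ φ w := fun h => huw (hφinj h)
    have hvw' : φ v ≠ φ w := fun h => hvw (hφinj h)
    rw [QP.C_iff hT hrange huw, QP.C_iff hH hmrange huw']
    simp only [QP.C_lab_iff hT hrange huw, QP.C_lab_iff hT hrange hvw,
      QP.C_lab_iff hH hmrange huw', QP.C_lab_iff hH hmrange hvw', hφ u _ _, hφ v _ _, hφ w _ _]
  refine ⟨⟨Equiv.ofBijective φ hbij, ?_⟩, ?_⟩
  · intro u v
    simp only [Equiv.ofBijective_apply]
    rw [QP.adj_iff hT.1, QP.adj_iff hH.1]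
    constructor
    · rintro ⟨h1, h2⟩
      refine ⟨fun h => h1 (by rw [h]), fun w hu hv => ?_⟩
      exact (hC u v w hu.symm hv.symm).2
        (h2 _ (fun h => hu (hφinj h)) (fun h => hv (hφinj h)))
    · rintro ⟨h1, h2⟩
      refine ⟨fun h => h1 (hφinj h), fun w hu hv => ?_⟩
      obtain ⟨w, rfl⟩ := hbij.2 w
      have hu' : w ≠ u := fun h => hu (by rw [h])
      have hv' : w ≠ v := fun h => hv (by rw [h])
      exact (hC u v w hu'.symm hv'.symm).1 (h2 w hu' hv')
  · intro x
    apply QP.same_inj hH hmrange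
    intro a b
    exact (hφ (ℓ x) a b).symm.trans (QP.same_leaf hT.1 hH.1 hinj hm hrange hmrange x a b)
end

section
/- For n ≥ 5, a set of fewer than n − 3 quartets cannot be definitive for binary trees on n leaves: for any set Q of at most n − 4 quartets on subsets of an n-element leaf set, if some binary tree on the n leaves displays all quartets in Q, then at least two non-isomorphic binary trees on the n leaves display all quartets in Q. -/
open SimpleGraph

variable {V : Type*}

variable {X : Type*}

namespace QProof

lemma reach_aux {G : SimpleGraph V} {u v x y : V} (w : G.Walk x y)
    (h : u ∉ w.support ∨ v ∉ w.support) :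
    ∀ z ∈ w.support, (G.deleteEdges {s(u, v)}).Reachable x z := by
  induction w with
  | nil => intro z hz; simp at hz; subst hz; exact Reachable.refl _
  | @cons a b c hab p ih =>
    intro z hz
    rw [Walk.support_cons, List.mem_cons] at hz
    rcases hz with rfl | hz
    · exact Reachable.refl _
    · have h' : u ∉ p.support ∨ v ∉ p.support := by
        rw [Walk.support_cons] at h; simp only [List.mem_cons] at h; tauto
      refine Reachable.trans (Adj.reachable ?_) (ih h' z hz)
      rw [deleteEdges_adj]
      refine ⟨hab, ?_⟩
      have hb : b ∈ p.support := p.start_mem_support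
      rw [Walk.support_cons] at h; simp only [List.mem_cons] at h
      simp only [Set.mem_singleton_iff, Sym2.eq_iff]
      rintro (⟨rfl, rfl⟩ | ⟨rfl, rfl⟩) <;> tauto

lemma reach_del {G : SimpleGraph V} {u v x y z z' : V} (w : G.Walk x y)
    (h : u ∉ w.support ∨ v ∉ w.support) (hz : z ∈ w.support) (hz' : z' ∈ w.support) :
    (G.deleteEdges {s(u, v)}).Reachable z z' :=
  (reach_aux w h z hz).symm.trans (reach_aux w h z' hz')

lemma no_reach {G : SimpleGraph V} (hG : G.IsAcyclic) {u v : V} (h : G.Adj u v) :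
    ¬ (G.deleteEdges {s(u, v)}).Reachable u v :=
  isBridge_iff.1 (isAcyclic_iff_forall_adj_isBridge.1 hG h)

/-- two disjoint walks are linked by at most one edge -/
lemma link_unique {G : SimpleGraph V} (hG : G.IsAcyclic) {a b c d : V}
    (p : G.Walk a b) (r : G.Walk c d) (hd : ∀ u ∈ p.support, u ∉ r.support)
    {u v u' v' : V} (huv : G.Adj u v) (huv' : G.Adj u' v')
    (hu : u ∈ p.support) (hu' : u' ∈ p.support) (hv : v ∈ r.support) (hv' : v' ∈ r.support) :
    s(u, v) = s(u', v') := by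
  by_contra hne
  apply no_reach hG huv
  have h1 : v ∉ p.support := fun h => hd _ h hv
  have h2 : u ∉ r.support := hd _ hu
  refine ((reach_del p (Or.inr h1) hu hu').trans (Adj.reachable ?_)).trans
    (reach_del r (Or.inl h2) hv' hv)
  rw [deleteEdges_adj]
  exact ⟨huv', fun h => hne (by simpa using h.symm)⟩

lemma disj_of {G : SimpleGraph V} (hG : G.IsAcyclic) {a b c d u v : V} (huv : G.Adj u v)
    (p : G.Walk a b) (r : G.Walk c d) (h1 : u ∈ p.support) (h2 : v ∉ p.support)
    (h3 : v ∈ r.support) (h4 : u ∉ r.support) : ∀ y ∈ p.support, y ∉ r.support := by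
  intro y hy hy'
  exact no_reach hG huv ((reach_del p (Or.inr h2) h1 hy).trans (reach_del r (Or.inl h4) hy' h3))

lemma last_exit {G : SimpleGraph V} (P : Set V) {x y : V} (w : G.Walk x y) (hy : y ∉ P) :
    (∀ z ∈ w.support, z ∉ P) ∨ ∃ (p t : V) (r : G.Walk t y), p ∈ P ∧ G.Adj p t ∧
      p ∈ w.support ∧ t ∈ w.support ∧ ∀ z ∈ r.support, z ∉ P := by
  induction w with
  | nil => left; intro z hz; simp at hz; subst hz; exact hy
  | @cons a b c hab q ih =>
    rcases ih hy with h | ⟨p, t, r, h1, h2, h3, h4, h5⟩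
    · by_cases ha : a ∈ P
      · right
        exact ⟨a, b, q, ha, hab, by simp, by simp, h⟩
      · left
        intro z hz
        rw [Walk.support_cons, List.mem_cons] at hz
        rcases hz with rfl | hz
        · exact ha
        · exact h z hz
    · right
      exact ⟨p, t, r, h1, h2, by simp [h3], by simp [h4], h5⟩

lemma not_both {G : SimpleGraph V} (hG : G.IsAcyclic) {a b c d : V}
    (h1 : Displays G a b c d) (h2 : Displays G a c b d) : False := by
  obtain ⟨P, R, hPR⟩ := h1
  obtain ⟨S, T, hST⟩ := h2
  have hc : c ∉ {z | z ∈ P.support} := fun h => hPR _ h R.start_mem_support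
  rcases last_exit {z | z ∈ P.support} S hc with h | ⟨p, t, r, hp, hpt, hpS, htS, hr⟩
  · exact h a S.start_mem_support P.start_mem_support
  · have ht : t ∉ P.support := hr t r.start_mem_support
    apply no_reach hG hpt
    refine (reach_del P (Or.inr ht) hp P.end_mem_support).trans ?_
    refine (reach_del T (Or.inl (hST _ hpS)) T.start_mem_support T.end_mem_support).trans ?_
    refine (reach_del R (Or.inl (hPR _ hp)) R.end_mem_support R.start_mem_support).trans ?_
    exact reach_del r (Or.inl fun h => hr _ h hp) r.end_mem_support r.start_mem_support

lemma avoid_nbr {G : SimpleGraph V} (hG : G.IsAcyclic) {u a v x : V} (hua : G.Adj u a)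
    (huv : G.Adj u v) (hav : a ≠ v) (w : G.Walk a x) (hw : u ∉ w.support) : v ∉ w.support := by
  intro hv
  apply no_reach hG huv
  refine (Adj.reachable ?_).trans (reach_del w (Or.inl hw) w.start_mem_support hv)
  rw [deleteEdges_adj]
  refine ⟨hua, ?_⟩
  simp only [Set.mem_singleton_iff, Sym2.eq_iff]
  rintro (⟨_, h⟩ | ⟨h, h'⟩)
  · exact hav h
  · exact hua.ne h'.symm

lemma exists_leaf [Finite V] {G : SimpleGraph V} (hG : G.IsAcyclic)
    (h3 : ∀ v, IsLeaf G v ∨ IsDeg3 G v) : ∀ (k : ℕ) (u a : V), G.Adj u a →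
    {y | ∃ w : G.Walk a y, u ∉ w.support}.ncard ≤ k →
    ∃ x, IsLeaf G x ∧ ∃ w : G.Walk a x, u ∉ w.support := by
  intro k
  induction k with
  | zero =>
    intro u a hua h
    exfalso
    have h0 := (Set.ncard_eq_zero (Set.toFinite _)).1 (Nat.le_zero.1 h)
    have : a ∈ {y | ∃ w : G.Walk a y, u ∉ w.support} := ⟨Walk.nil, by simpa using hua.ne⟩
    rw [h0] at this; exact this
  | succ k ih =>
    intro u a hua h
    rcases h3 a with hl | hd
    · exact ⟨a, hl, Walk.nil, by simpa using hua.ne⟩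
    · have : ∃ a', G.Adj a a' ∧ a' ≠ u := by
        obtain ⟨p, q, r, hpq, _, _, hp, hq, _⟩ := hd
        by_cases hpu : p = u
        · exact ⟨q, hq, fun h => hpq (hpu.trans h.symm)⟩
        · exact ⟨p, hp, hpu⟩
      obtain ⟨a', haa', hne⟩ := this
      have key : ∀ y (w : G.Walk a' y), a ∉ w.support → u ∉ w.support := fun y w hw =>
        avoid_nbr hG haa' hua.symm hne w hw
      have hss : {y | ∃ w : G.Walk a' y, a ∉ w.support} ⊂ {y | ∃ w : G.Walk a y, u ∉ w.support} := by
        refine ⟨?_, ?_⟩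
        · rintro y ⟨w, hw⟩
          exact ⟨Walk.cons haa' w, by simp [key y w hw, hua.ne]⟩
        · intro hsub
          obtain ⟨w, hw⟩ := hsub (⟨Walk.nil, by simpa using hua.ne⟩ : a ∈ {y | ∃ w : G.Walk a y, u ∉ w.support})
          exact hw w.end_mem_support
      have := Set.ncard_lt_ncard hss (Set.toFinite _)
      obtain ⟨x, hx, w, hw⟩ := ih a a' haa' (by omega)
      exact ⟨x, hx, Walk.cons haa' w, by simp [key x w hw, hua.ne]⟩

lemma leaf_iff {G : SimpleGraph V} {v : V} : IsLeaf G v ↔ (G.neighborSet v).ncard = 1 := by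
  rw [Set.ncard_eq_one]
  constructor
  · rintro ⟨u, hu, h⟩
    exact ⟨u, by ext z; simp only [mem_neighborSet, Set.mem_singleton_iff]; exact ⟨h z, fun e => e ▸ hu⟩⟩
  · rintro ⟨u, hu⟩
    have : ∀ z, G.Adj v z ↔ z = u := fun z => by rw [← mem_neighborSet, hu]; rfl
    exact ⟨u, (this u).2 rfl, fun z hz => (this z).1 hz⟩

lemma deg3_iff {G : SimpleGraph V} {v : V} : IsDeg3 G v ↔ (G.neighborSet v).ncard = 3 := by
  rw [Set.ncard_eq_three]
  constructor
  · rintro ⟨a, b, c, hab, hac, hbc, ha, hb, hc, h⟩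
    refine ⟨a, b, c, hab, hac, hbc, ?_⟩
    ext z; simp only [mem_neighborSet, Set.mem_singleton_iff, Set.mem_insert_iff]
    exact ⟨h z, by rintro (rfl | rfl | rfl) <;> assumption⟩
  · rintro ⟨a, b, c, hab, hac, hbc, hu⟩
    have : ∀ z, G.Adj v z ↔ z = a ∨ z = b ∨ z = c := fun z => by rw [← mem_neighborSet, hu]; rfl
    exact ⟨a, b, c, hab, hac, hbc, (this _).2 (by simp), (this _).2 (by simp), (this _).2 (by simp),
      fun z hz => (this z).1 hz⟩

lemma edge_count [Fintype V] {G : SimpleGraph V} (h3 : ∀ v, IsLeaf G v ∨ IsDeg3 G v) :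
    2 * Nat.card G.edgeSet + 2 * {v | IsLeaf G v}.ncard = 3 * Fintype.card V := by
  classical
  have h := G.sum_degrees_eq_twice_card_edges
  have e1 : Nat.card G.edgeSet = G.edgeFinset.card := by
    rw [Nat.card_eq_fintype_card, edgeFinset_card]
  have e2 : {v | IsLeaf G v}.ncard = ∑ v : V, if IsLeaf G v then 1 else 0 := by
    rw [← Finset.card_filter, Set.ncard_eq_toFinset_card']
    congr 1; ext; simp
  have e3 : Fintype.card V = ∑ v : V, 1 := by simp
  rw [e1, ← h, e2, e3, Finset.mul_sum, Finset.mul_sum, ← Finset.sum_add_distrib]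
  refine Finset.sum_congr rfl fun v _ => ?_
  have hd : G.degree v = (G.neighborSet v).ncard := by
    rw [Set.ncard_eq_toFinset_card', degree, neighborFinset]
  rcases h3 v with hl | hl
  · rw [if_pos hl, hd, leaf_iff.1 hl]; rfl
  · have h3 := deg3_iff.1 hl
    have : ¬ IsLeaf G v := fun h => by rw [leaf_iff] at h; omega
    rw [if_neg this, hd, h3]; rfl

/-- NNI move -/
def nni (G : SimpleGraph V) (u v b c : V) (huc : u ≠ c) (hvb : v ≠ b) : SimpleGraph V where
  Adj x y := (G.Adj x y ∧ s(x, y) ≠ s(u, b) ∧ s(x, y) ≠ s(v, c)) ∨ s(x, y) = s(u, c) ∨ s(x, y) = s(v, b)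
  symm := ⟨fun x y h => by rw [Sym2.eq_swap (a := y), G.adj_comm]; exact h⟩
  loopless := ⟨fun x h => by
    rcases h with h | h | h
    · exact G.loopless.irrefl x h.1
    · rw [Sym2.eq_iff] at h; grind
    · rw [Sym2.eq_iff] at h; grind⟩

lemma nni_deg (G : SimpleGraph V) {u v b c : V} (huc : u ≠ c) (hvb : v ≠ b) (huv : G.Adj u v)
    (hub : G.Adj u b) (hvc : G.Adj v c) (hbc : b ≠ c) (hnvb : ¬ G.Adj v b) (hnuc : ¬ G.Adj u c)
    (x : V) : ((nni G u v b c huc hvb).neighborSet x).ncard = (G.neighborSet x).ncard := by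
  classical
  have key : ∃ σ : Equiv.Perm V, ∀ y, (nni G u v b c huc hvb).Adj x y ↔ G.Adj x (σ y) := by
    have := huv.ne
    have := hub.ne
    have := hvc.ne
    have s1 := huv.symm
    have s2 := hub.symm
    have s3 := hvc.symm
    have s4 : ¬ G.Adj b v := fun h => hnvb h.symm
    have s5 : ¬ G.Adj c u := fun h => hnuc h.symm
    by_cases h1 : x = u ∨ x = v
    · refine ⟨Equiv.swap b c, fun y => ?_⟩
      simp only [nni, Sym2.eq_iff, Equiv.swap_apply_def, ne_eq]
      grind
    · by_cases h2 : x = b ∨ x = c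
      · refine ⟨Equiv.swap u v, fun y => ?_⟩
        simp only [nni, Sym2.eq_iff, Equiv.swap_apply_def, ne_eq]
        grind
      · refine ⟨Equiv.refl _, fun y => ?_⟩
        simp only [nni, Sym2.eq_iff, Equiv.refl_apply, ne_eq]
        grind
  obtain ⟨σ, hσ⟩ := key
  have : (nni G u v b c huc hvb).neighborSet x = σ ⁻¹' (G.neighborSet x) := by
    ext y; exact hσ y
  rw [this, Set.ncard_preimage_of_injective_subset_range σ.injective]
  rw [σ.surjective.range_eq]; exact Set.subset_univ _

lemma nni_walk (G : SimpleGraph V) {u v b c : V} (huc : u ≠ c) (hvb : v ≠ b) (huv : G.Adj u v)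
    (hub : u ≠ b) (hvc : v ≠ c) {x y : V} (w : G.Walk x y) :
    ∃ w' : (nni G u v b c huc hvb).Walk x y,
      (∀ z ∈ w'.support, z ∈ w.support ∨ ((u ∈ w.support ∨ v ∈ w.support) ∧ (z = u ∨ z = v))) := by
  have n1 : (nni G u v b c huc hvb).Adj u v := by
    left; refine ⟨huv, ?_, ?_⟩ <;> simp only [ne_eq, Sym2.eq_iff] <;> grind
  have n2 : (nni G u v b c huc hvb).Adj u c := Or.inr (Or.inl rfl)
  have n3 : (nni G u v b c huc hvb).Adj v b := Or.inr (Or.inr rfl)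
  induction w with
  | nil => exact ⟨Walk.nil, by simp⟩
  | @cons p q r hpq w ih =>
    obtain ⟨w', hw'⟩ := ih
    have hq : q ∈ w.support := w.start_mem_support
    by_cases h1 : s(p, q) = s(u, b)
    · rw [Sym2.eq_iff] at h1
      rcases h1 with ⟨rfl, rfl⟩ | ⟨rfl, rfl⟩
      · refine ⟨Walk.cons n1 (Walk.cons n3 w'), ?_⟩
        simp only [Walk.support_cons, List.mem_cons]; grind
      · refine ⟨Walk.cons n3.symm (Walk.cons n1.symm w'), ?_⟩
        simp only [Walk.support_cons, List.mem_cons]; grind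
    · by_cases h2 : s(p, q) = s(v, c)
      · rw [Sym2.eq_iff] at h2
        rcases h2 with ⟨rfl, rfl⟩ | ⟨rfl, rfl⟩
        · refine ⟨Walk.cons n1.symm (Walk.cons n2 w'), ?_⟩
          simp only [Walk.support_cons, List.mem_cons]; grind
        · refine ⟨Walk.cons n2.symm (Walk.cons n1 w'), ?_⟩
          simp only [Walk.support_cons, List.mem_cons]; grind
      · refine ⟨Walk.cons (Or.inl ⟨hpq, h1, h2⟩) w', ?_⟩
        simp only [Walk.support_cons, List.mem_cons]; grind

lemma nni_displays (G : SimpleGraph V) {u v b c : V} (huc : u ≠ c) (hvb : v ≠ b) (huv : G.Adj u v)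
    (hub : u ≠ b) (hvc : v ≠ c) {x y z t : V} (P : G.Walk x y) (R : G.Walk z t)
    (hd : ∀ a ∈ P.support, a ∉ R.support)
    (h1 : ¬ (u ∈ P.support ∧ v ∈ R.support)) (h2 : ¬ (v ∈ P.support ∧ u ∈ R.support)) :
    Displays (nni G u v b c huc hvb) x y z t := by
  obtain ⟨P', hP⟩ := nni_walk G huc hvb huv hub hvc P
  obtain ⟨R', hR⟩ := nni_walk G huc hvb huv hub hvc R
  refine ⟨P', R', fun a ha hb => ?_⟩
  have := hP a ha
  have := hR a hb
  have := hd u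
  have := hd v
  have := hd a
  grind

lemma binary_iso {W : Type*} {G : SimpleGraph V} {H : SimpleGraph W} (φ : G ≃g H) :
    (∀ v, IsLeaf H (φ v) ↔ IsLeaf G v) ∧ (∀ v, IsDeg3 H (φ v) ↔ IsDeg3 G v) := by
  have : ∀ v, (H.neighborSet (φ v)).ncard = (G.neighborSet v).ncard := by
    intro v
    exact (Nat.card_congr (φ.mapNeighborSet v)).symm
  simp only [leaf_iff, deg3_iff, this, implies_true, and_self]

lemma displays_iso {W : Type*} {G : SimpleGraph V} {H : SimpleGraph W} (φ : G ≃g H) {a b c d : V}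
    (h : Displays G a b c d) : Displays H (φ a) (φ b) (φ c) (φ d) := by
  obtain ⟨P, R, h⟩ := h
  refine ⟨P.map φ.toHom, R.map φ.toHom, ?_⟩
  intro z hz hz'
  rw [Walk.support_map, List.mem_map] at hz hz'
  obtain ⟨y, hy, rfl⟩ := hz
  obtain ⟨y', hy', h'⟩ := hz'
  have : y' = y := φ.injective h'
  subst this
  exact h _ hy hy'

lemma other_nbrs {G : SimpleGraph V} {u v : V} (h : IsDeg3 G u) (huv : G.Adj u v) :
    ∃ a b, a ≠ b ∧ a ≠ v ∧ b ≠ v ∧ G.Adj u a ∧ G.Adj u b := by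
  obtain ⟨p, q, r, hpq, hpr, hqr, hp, hq, hr, h⟩ := h
  rcases h v huv with rfl | rfl | rfl
  · exact ⟨q, r, hqr, hpq.symm, hpr.symm, hq, hr⟩
  · exact ⟨p, r, hpr, hpq, hqr.symm, hp, hr⟩
  · exact ⟨p, q, hpq, hpr, hqr, hp, hq⟩

lemma no_tri {G : SimpleGraph V} (hG : G.IsAcyclic) {u v a : V} (huv : G.Adj u v)
    (hua : G.Adj u a) (hva : G.Adj v a) : False := by
  refine avoid_nbr hG hua huv hva.ne.symm (Walk.cons hva.symm Walk.nil) ?_ ?_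
  · simp [hua.ne, huv.ne]
  · simp

lemma core_nni [Fintype V] {G : SimpleGraph V} (hT : IsBinaryTree G) {u v : V} (huv : G.Adj u v)
    (hu : IsDeg3 G u) (hv : IsDeg3 G v) : ∃ H : SimpleGraph V, IsBinaryTree H ∧
      (∀ x, IsLeaf H x ↔ IsLeaf G x) ∧
      (∀ (x y z t : V) (P : G.Walk x y) (R : G.Walk z t), (∀ a ∈ P.support, a ∉ R.support) →
        ¬ (u ∈ P.support ∧ v ∈ R.support) → ¬ (v ∈ P.support ∧ u ∈ R.support) →
        Displays H x y z t) ∧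
      ∃ x y z t, IsLeaf G x ∧ IsLeaf G y ∧ IsLeaf G z ∧ IsLeaf G t ∧ Displays G x y z t ∧
        Displays H x z y t := by
  obtain ⟨a, b, hab, hav, hbv, hua, hub⟩ := other_nbrs hu huv
  obtain ⟨c, d, hcd, hcu, hdu, hvc, hvd⟩ := other_nbrs hv huv.symm
  have hA := hT.1.isAcyclic
  have hnvb : ¬ G.Adj v b := fun h => no_tri hA huv hub h
  have hnuc : ¬ G.Adj u c := fun h => no_tri hA huv h hvc
  have hnva : ¬ G.Adj v a := fun h => no_tri hA huv hua h
  have hnud : ¬ G.Adj u d := fun h => no_tri hA huv h hvd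
  have hbc : b ≠ c := fun h => hnuc (h ▸ hub)
  have hdeg := nni_deg G hcu.symm hbv.symm huv hub hvc hbc hnvb hnuc
  have hdisp := fun (x y z t : V) (P : G.Walk x y) (R : G.Walk z t) =>
    nni_displays G hcu.symm hbv.symm huv hub.ne hvc.ne P R
  have hwalk := fun (x y : V) (w : G.Walk x y) => nni_walk G hcu.symm hbv.symm huv hub.ne hvc.ne w
  have n1 : (nni G u v b c hcu.symm hbv.symm).Adj u v := by
    left; refine ⟨huv, ?_, ?_⟩ <;> simp only [ne_eq, Sym2.eq_iff] <;> grind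
  have n2 : (nni G u v b c hcu.symm hbv.symm).Adj u c := Or.inr (Or.inl rfl)
  have n3 : (nni G u v b c hcu.symm hbv.symm).Adj v b := Or.inr (Or.inr rfl)
  have n4 : (nni G u v b c hcu.symm hbv.symm).Adj u a := by
    left; refine ⟨hua, ?_, ?_⟩ <;> simp only [ne_eq, Sym2.eq_iff] <;> grind
  have n5 : (nni G u v b c hcu.symm hbv.symm).Adj v d := by
    left; refine ⟨hvd, ?_, ?_⟩ <;> simp only [ne_eq, Sym2.eq_iff] <;> grind
  generalize nni G u v b c hcu.symm hbv.symm = H at *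
  have hleaf : ∀ x, IsLeaf H x ↔ IsLeaf G x := fun x => by rw [leaf_iff, leaf_iff, hdeg]
  have h3 : ∀ x, IsLeaf H x ∨ IsDeg3 H x := fun x => by
    rw [hleaf, deg3_iff, hdeg, ← deg3_iff]; exact hT.2 x
  have hHT : H.IsTree := by
    rw [isTree_iff_connected_and_card]
    have hG := (isTree_iff_connected_and_card.1 hT.1)
    refine ⟨?_, ?_⟩
    · have := hG.1.nonempty
      refine ⟨fun x y => ?_⟩
      obtain ⟨w⟩ := hG.1.preconnected x y
      obtain ⟨w', _⟩ := hwalk x y w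
      exact ⟨w'⟩
    · have e1 := edge_count hT.2
      have e2 := edge_count h3
      have : {v | IsLeaf H v} = {v | IsLeaf G v} := by ext x; exact hleaf x
      rw [this] at e2
      have := hG.2
      omega
  refine ⟨H, ⟨hHT, h3⟩, hleaf, hdisp, ?_⟩
  obtain ⟨x, hx, wx, hwx⟩ := exists_leaf hA hT.2 _ u a hua le_rfl
  obtain ⟨y, hy, wy, hwy⟩ := exists_leaf hA hT.2 _ u b hub le_rfl
  obtain ⟨z, hz, wz, hwz⟩ := exists_leaf hA hT.2 _ v c hvc le_rfl
  obtain ⟨t, ht, wt, hwt⟩ := exists_leaf hA hT.2 _ v d hvd le_rfl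
  have hwx' := avoid_nbr hA hua huv hav wx hwx
  have hwy' := avoid_nbr hA hub huv hbv wy hwy
  have hwz' := avoid_nbr hA hvc huv.symm hcu wz hwz
  have hwt' := avoid_nbr hA hvd huv.symm hdu wt hwt
  have q1 := huv.ne
  have q2 := hua.ne
  have q3 := hub.ne
  have q4 := hvc.ne
  have q5 := hvd.ne
  clear hdisp
  refine ⟨x, y, z, t, hx, hy, hz, ht, ?_, ?_⟩
  · refine ⟨(wx.reverse.append (Walk.cons hua.symm (Walk.cons hub wy))),
      (wz.reverse.append (Walk.cons hvc.symm (Walk.cons hvd wt))), ?_⟩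
    apply disj_of hA huv
    all_goals simp only [Walk.mem_support_append_iff, Walk.support_cons, Walk.support_reverse,
      List.mem_cons, List.mem_reverse]
    all_goals grind
  · have tr : ∀ p q (w : G.Walk p q), u ∉ w.support → v ∉ w.support →
        ∃ w' : H.Walk p q, u ∉ w'.support ∧ v ∉ w'.support := by
      intro p q w h1 h2
      obtain ⟨w', hw'⟩ := hwalk p q w
      refine ⟨w', fun h => ?_, fun h => ?_⟩
      · have := hw' _ h; tauto
      · have := hw' _ h; tauto
    obtain ⟨wx2, hx1, hx2⟩ := tr _ _ wx hwx hwx'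
    obtain ⟨wy2, hy1, hy2⟩ := tr _ _ wy hwy hwy'
    obtain ⟨wz2, hz1, hz2⟩ := tr _ _ wz hwz' hwz
    obtain ⟨wt2, ht1, ht2⟩ := tr _ _ wt hwt' hwt
    refine ⟨(wx2.reverse.append (Walk.cons n4.symm (Walk.cons n2 wz2))),
      (wy2.reverse.append (Walk.cons n3.symm (Walk.cons n5 wt2))), ?_⟩
    clear tr hwalk
    apply disj_of hHT.isAcyclic n1
    all_goals simp only [Walk.mem_support_append_iff, Walk.support_cons, Walk.support_reverse,
      List.mem_cons, List.mem_reverse]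
    all_goals grind

lemma internal_count [Fintype V] {G : SimpleGraph V} :
    Nat.card G.edgeSet ≤ {e | e ∈ G.edgeSet ∧ ∀ x ∈ e, ¬ IsLeaf G x}.ncard
      + {v | IsLeaf G v}.ncard := by
  classical
  have hch : ∀ v, ∃ u, IsLeaf G v → ∀ y, G.Adj v y → y = u := by
    intro v
    by_cases h : IsLeaf G v
    · obtain ⟨u, _, hu⟩ := h
      exact ⟨u, fun _ => hu⟩
    · exact ⟨v, fun h' => absurd h' h⟩
  choose f hf using hch
  have : G.edgeSet ⊆ {e | e ∈ G.edgeSet ∧ ∀ x ∈ e, ¬ IsLeaf G x} ∪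
      (fun v => s(v, f v)) '' {v | IsLeaf G v} := by
    intro e he
    by_cases h : ∀ x ∈ e, ¬ IsLeaf G x
    · exact Or.inl ⟨he, h⟩
    · right
      push Not at h
      obtain ⟨x, hx, hl⟩ := h
      obtain ⟨y, rfl⟩ := Sym2.mem_iff_exists.1 hx
      refine ⟨x, hl, ?_⟩
      rw [hf x hl y he]
  have h1 := Set.ncard_le_ncard this (Set.toFinite _)
  have h2 := Set.ncard_union_le {e | e ∈ G.edgeSet ∧ ∀ x ∈ e, ¬ IsLeaf G x}
      ((fun v => s(v, f v)) '' {v | IsLeaf G v})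
  have h3 := Set.ncard_image_le (f := fun v => s(v, f v)) (Set.toFinite {v | IsLeaf G v})
  rw [Nat.card_coe_set_eq]
  omega

lemma core [Fintype V] [Fintype X] (n : ℕ) (hn : 5 ≤ n)
    (hX : Nat.card X = n)
    (Q : Set (Sym2 (Sym2 X))) (hQ : Q.ncard ≤ n - 4)
    (G : SimpleGraph V) (ℓ : X → V) (hT : IsBinaryTree G)
    (hinj : Function.Injective ℓ) (hrange : Set.range ℓ = {v | IsLeaf G v})
    (hdisp : ∀ q ∈ Q, DisplaysQ G ℓ q) :
    Fintype.card V = 2 * n - 2 ∧ ∃ H : SimpleGraph V, IsBinaryTree H ∧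
      Set.range ℓ = {v | IsLeaf H v} ∧ (∀ q ∈ Q, DisplaysQ H ℓ q) ∧
      ¬ ∃ φ : G ≃g H, ∀ x, φ (ℓ x) = ℓ x := by
  have hA := hT.1.isAcyclic
  have hL : {v | IsLeaf G v}.ncard = n := by
    rw [← hrange, ← Set.image_univ, Set.ncard_image_of_injective _ hinj, Set.ncard_univ, hX]
  have e1 := edge_count hT.2
  have e2 := (isTree_iff_connected_and_card.1 hT.1).2
  have e3 := internal_count (G := G)
  rw [hL] at e1 e3
  rw [Nat.card_eq_fintype_card (α := V)] at e2
  refine ⟨by omega, ?_⟩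
  have hlt : Q.ncard < {e | e ∈ G.edgeSet ∧ ∀ x ∈ e, ¬ IsLeaf G x}.ncard := by omega
  choose a b c d hab hac had hbc hbd hcd hq P R hPR using hdisp
  have hex : ∃ u v, G.Adj u v ∧ ¬ IsLeaf G u ∧ ¬ IsLeaf G v ∧ ∀ q hq,
      ¬ (u ∈ (P q hq).support ∧ v ∈ (R q hq).support) ∧
      ¬ (v ∈ (P q hq).support ∧ u ∈ (R q hq).support) := by
    by_contra hcon
    have hall : ∀ e ∈ {e | e ∈ G.edgeSet ∧ ∀ x ∈ e, ¬ IsLeaf G x}, ∃ q ∈ Q, ∃ hq : q ∈ Q,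
        ∃ u v, e = s(u, v) ∧ G.Adj u v ∧ u ∈ (P q hq).support ∧ v ∈ (R q hq).support := by
      intro e
      induction e with | _ u v
      rintro ⟨he, hl⟩
      by_contra hno
      refine hcon ⟨u, v, he, hl u (by simp), hl v (by simp), fun q hq => ⟨?_, ?_⟩⟩
      · rintro ⟨h1, h2⟩
        exact hno ⟨q, hq, hq, u, v, rfl, he, h1, h2⟩
      · rintro ⟨h1, h2⟩
        exact hno ⟨q, hq, hq, v, u, Sym2.eq_swap, G.adj_symm he, h1, h2⟩
    have hne : Nonempty X := by
      by_contra h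
      rw [not_nonempty_iff] at h
      simp at hX
      omega
    have hne2 : Nonempty (Sym2 (Sym2 X)) := hne.elim fun x => ⟨s(s(x, x), s(x, x))⟩
    choose! f hfQ hf using hall
    have := Set.ncard_le_ncard_of_injOn f hfQ (by
      intro e he e' he' hee
      obtain ⟨h, u, v, rfl, huv, hu, hv⟩ := hf e he
      obtain ⟨h', u', v', rfl, huv', hu', hv'⟩ := hf e' he'
      generalize f s(u', v') = q at *
      generalize f s(u, v) = q' at *
      subst hee
      exact link_unique hA _ _ (hPR _ h) huv huv' hu hu' hv hv') (Set.toFinite Q)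
    omega
  obtain ⟨u, v, huv, hu, hv, hlink⟩ := hex
  obtain ⟨H, hH, hleaf, hD, x, y, z, t, hx, hy, hz, ht, hdG, hdH⟩ := core_nni hT huv
    ((hT.2 u).resolve_left hu) ((hT.2 v).resolve_left hv)
  refine ⟨H, hH, ?_, ?_, ?_⟩
  · rw [hrange]; ext x; exact (hleaf x).symm
  · intro q h
    exact ⟨a q h, b q h, c q h, d q h, hab q h, hac q h, had q h, hbc q h, hbd q h, hcd q h, hq q h,
      hD _ _ _ _ (P q h) (R q h) (hPR q h) (hlink q h).1 (hlink q h).2⟩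
  · rintro ⟨φ, hφ⟩
    have hl : ∀ x, IsLeaf G x → φ x = x := by
      intro x hx
      have : x ∈ Set.range ℓ := by rw [hrange]; exact hx
      obtain ⟨x', rfl⟩ := this
      exact hφ x'
    have := displays_iso φ hdG
    rw [hl x hx, hl y hy, hl z hz, hl t ht] at this
    exact not_both hH.1.isAcyclic this hdH

lemma transport {W : Type*} (e : V ≃ W) (G : SimpleGraph V) (ℓ : X → V) (Q : Set (Sym2 (Sym2 X)))
    (hT : IsBinaryTree G) (hrange : Set.range ℓ = {v | IsLeaf G v})
    (hdisp : ∀ q ∈ Q, DisplaysQ G ℓ q) : ∃ H : SimpleGraph W, ∃ φ : G ≃g H, (∀ v, φ v = e v) ∧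
      IsBinaryTree H ∧ Set.range (e ∘ ℓ) = {v | IsLeaf H v} ∧ ∀ q ∈ Q, DisplaysQ H (e ∘ ℓ) q := by
  refine ⟨G.map e, SimpleGraph.Iso.map e G, fun v => rfl, ?_⟩
  have hφ : ∀ v, (SimpleGraph.Iso.map e G) v = e v := fun v => rfl
  generalize SimpleGraph.Iso.map e G = φ at *
  obtain ⟨h1, h2⟩ := binary_iso φ
  refine ⟨⟨φ.isTree_iff.1 hT.1, fun w => ?_⟩, ?_, ?_⟩
  · obtain ⟨v, rfl⟩ := φ.surjective w
    rw [h1, h2]; exact hT.2 v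
  · rw [Set.range_comp, hrange]
    ext w
    obtain ⟨v, rfl⟩ := φ.surjective w
    simp only [Set.mem_image, Set.mem_ofPred_eq, h1, ← hφ]
    constructor
    · rintro ⟨x, hx, h⟩
      rwa [← φ.injective h]
    · intro h; exact ⟨v, h, rfl⟩
  · intro q hq
    obtain ⟨a, b, c, d, k1, k2, k3, k4, k5, k6, k7, k8⟩ := hdisp q hq
    refine ⟨a, b, c, d, k1, k2, k3, k4, k5, k6, k7, ?_⟩
    have := displays_iso φ k8
    simp only [hφ] at this
    exact this

end QProof

/-- For `n ≥ 5`, a set of fewer than `n - 3` quartets cannot be definitive for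
binary trees on `n` leaves: for any set `Q` of at most `n - 4` quartets on
subsets of an `n`-element leaf set, if some binary phylogenetic tree displays
all quartets in `Q`, then there are at least two non-isomorphic binary
phylogenetic trees on those leaves displaying all quartets in `Q`. (Any binary
tree on `n` leaves has `2n - 2` vertices, so they may be taken to have vertex
set `Fin (2n - 2)`.) -/
theorem stmt18 {V X : Type*} [Fintype V] [Fintype X] (n : ℕ) (hn : 5 ≤ n)
    (hX : Nat.card X = n)
    (Q : Set (Sym2 (Sym2 X))) (hQ : Q.ncard ≤ n - 4)
    (G : SimpleGraph V) (ℓ : X → V) (hT : IsBinaryTree G)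
    (hinj : Function.Injective ℓ) (hrange : Set.range ℓ = {v | IsLeaf G v})
    (hdisp : ∀ q ∈ Q, DisplaysQ G ℓ q) :
    ∃ (H1 H2 : SimpleGraph (Fin (2 * n - 2))) (m1 m2 : X → Fin (2 * n - 2)),
      IsBinaryTree H1 ∧ IsBinaryTree H2 ∧
      Function.Injective m1 ∧ Function.Injective m2 ∧
      Set.range m1 = {v | IsLeaf H1 v} ∧ Set.range m2 = {v | IsLeaf H2 v} ∧
      (∀ q ∈ Q, DisplaysQ H1 m1 q) ∧ (∀ q ∈ Q, DisplaysQ H2 m2 q) ∧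
      ¬ ∃ φ : H1 ≃g H2, ∀ x, φ (m1 x) = m2 x := by
  obtain ⟨hc, H, hH, hr, hd, hno⟩ := QProof.core n hn hX Q hQ G ℓ hT hinj hrange hdisp
  have e : V ≃ Fin (2 * n - 2) := Fintype.equivFinOfCardEq hc
  obtain ⟨H1, φ1, he1, hb1, hr1, hd1⟩ := QProof.transport e G ℓ Q hT hrange hdisp
  obtain ⟨H2, φ2, he2, hb2, hr2, hd2⟩ := QProof.transport e H ℓ Q hH hr hd
  refine ⟨H1, H2, e ∘ ℓ, e ∘ ℓ, hb1, hb2, e.injective.comp hinj, e.injective.comp hinj, hr1, hr2,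
    hd1, hd2, ?_⟩
  rintro ⟨φ, hφ⟩
  refine hno ⟨(φ1.trans φ).trans φ2.symm, fun x => ?_⟩
  have h := hφ x
  simp only [Function.comp_apply] at h
  change φ2.symm (φ (φ1 (ℓ x))) = ℓ x
  rw [he1, h, ← he2]
  exact φ2.symm_apply_apply _
end
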